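/- arXiv:2306.11328 — 2 statements merged into one kernel-verified Lean document; each statement's English description precedes it below -/
import Mathlib

section
/- For all integers n and r with 2 ≤ r ≤ n−2, the Mostar index satisfies Mo(S_{n,r}) < Mo(S_{n,r+1}). -/
open Finset SimpleGraph

open scoped Classical

/-- ψ(uv) = |n_u - n_v| for an edge, as a symmetric function on `Sym2 V`. -/
noncomputable def mostarPsi {V : Type*} [Fintype V] (G : SimpleGraph V) : Sym2 V → ℕ :=
  Sym2.lift ⟨fun u v =>
    (((Finset.univ.filter fun w => G.dist w u < G.dist w v).card : ℤ) -
      ((Finset.univ.filter fun w => G.dist w v < G.dist w u).card : ℤ)).natAbs,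
    fun u v => by dsimp only; omega⟩

/-- The Mostar index of a graph. -/
noncomputable def mostar {V : Type*} [Fintype V] (G : SimpleGraph V) : ℕ :=
  ∑ e ∈ G.edgeFinset, mostarPsi G e

/-- The graph on `Fin n` determined by a parent function. -/
def parentGraph (n : ℕ) (p : ℕ → ℕ) : SimpleGraph (Fin n) :=
  SimpleGraph.fromRel (fun u v => p u.val = v.val)

/-- S_{n,r}: r pendent paths of almost equal lengths at a common vertex. -/
def spiderS (n r : ℕ) : SimpleGraph (Fin n) :=
  parentGraph n (fun v => if v ≤ r then 0 else v - r)

/-- The star on n vertices. -/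
def starG (n : ℕ) : SimpleGraph (Fin n) :=
  parentGraph n (fun _ => 0)

/-- C_{n,a,b}. -/
def catC (n a b : ℕ) : SimpleGraph (Fin n) :=
  parentGraph n (fun v =>
    if v < n - a - b then v - 1
    else if v < n - b then v - (n - a - b) + 1
    else v - a - b - 1)

/-- F_{n,a,b}. -/
def catF (n a b : ℕ) : SimpleGraph (Fin n) :=
  parentGraph n (fun v =>
    if v < n - a - b - 2 then v - 1
    else if v = n - a - b - 2 then 1
    else if v < n - b then v - (n - a - b - 2)
    else v - a - b - 3)

/-- A^r_{n,a,b}. -/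
def treeA (n r a b : ℕ) : SimpleGraph (Fin n) :=
  parentGraph n (fun v =>
    if v < n - (a + b) * r then v - 1
    else if v < n - b * r then (if (v - (n - (a + b) * r)) % r = 0 then 0 else v - 1)
    else (if (v - (n - b * r)) % r = 0 then n - (a + b) * r - 1 else v - 1))

/-- S^r_{n,k}: k pendent paths of length r and n - k*r - 1 pendent edges at a common vertex. -/
def treeSrk (n r k : ℕ) : SimpleGraph (Fin n) :=
  parentGraph n (fun v =>
    if v < n - k * r then 0
    else if (v - (n - k * r)) % r = 0 then 0 else v - 1)

/-- Number of vertices of odd degree. -/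
noncomputable def oddDegreeCount {V : Type*} [Fintype V] (G : SimpleGraph V) : ℕ :=
  (Finset.univ.filter fun v => Odd (G.degree v)).card

/-- Number of vertices of degree two. -/
noncomputable def degreeTwoCount {V : Type*} [Fintype V] (G : SimpleGraph V) : ℕ :=
  (Finset.univ.filter fun v => G.degree v = 2).card

/-- Number of branch vertices (degree at least three). -/
noncomputable def branchCount {V : Type*} [Fintype V] (G : SimpleGraph V) : ℕ :=
  (Finset.univ.filter fun v => 3 ≤ G.degree v).card

/-- Number of pendent paths of length r in G. -/
noncomputable def pendentPathCount {V : Type*} [Fintype V] (G : SimpleGraph V) (r : ℕ) : ℕ :=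
  Nat.card { u : Fin (r + 1) → V //
    Function.Injective u ∧
    (∀ i : Fin r, G.Adj (u i.castSucc) (u i.succ)) ∧
    G.degree (u 0) = 1 ∧ 2 ≤ G.degree (u (Fin.last r)) ∧
    ∀ i : Fin (r + 1), i ≠ 0 → i ≠ Fin.last r → G.degree (u i) = 2 }

lemma dist_lt_of_cut {V : Type*} {G : SimpleGraph V} (hG : G.Connected) {u v : V} (T : Set V)
    (hv : v ∉ T) (hcut : ∀ a b, G.Adj a b → a ∈ T → b ∉ T → a = u ∧ b = v)
    {w : V} (hw : w ∈ T) : G.dist w u < G.dist w v := by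
  have key : ∀ (x y : V) (q : G.Walk x y), x ∈ T → y ∉ T → G.dist x u < q.length := by
    intro x y q
    induction q with
    | nil => intro h1 h2; exact absurd h1 h2
    | @cons a b c h q ih =>
      intro h1 h2
      rw [Walk.length_cons]
      by_cases hb : b ∈ T
      · have h3 := ih hb h2
        have h4 : G.dist a u ≤ G.dist a b + G.dist b u := hG.dist_triangle
        have h5 : G.dist a b = 1 := SimpleGraph.dist_eq_one_iff_adj.mpr h
        omega
      · obtain ⟨rfl, rfl⟩ := hcut a b h h1 hb
        simp
  obtain ⟨q, hq⟩ := hG.exists_walk_length_eq_dist w v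
  rw [← hq]
  exact key w v q hw hv

/-- Parent of a vertex in the spider. -/
def spPar (r v : ℕ) : ℕ := if v ≤ r then 0 else v - r

lemma spPar_lt {r v : ℕ} (hr : 2 ≤ r) (hv : 1 ≤ v) : spPar r v < v := by
  unfold spPar; split_ifs <;> omega

lemma spPar_le (r v : ℕ) : spPar r v ≤ v := by
  unfold spPar; split_ifs <;> omega

lemma spider_adj {n r : ℕ} (a b : Fin n) :
    (spiderS n r).Adj a b ↔ a ≠ b ∧ (spPar r a = b ∨ spPar r b = a) := by
  unfold spiderS parentGraph spPar
  rw [SimpleGraph.fromRel_adj]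

/-- Parent as an element of `Fin n`. -/
def spParF {n : ℕ} (r : ℕ) (v : Fin n) : Fin n := ⟨spPar r v, (spPar_le r v).trans_lt v.2⟩

lemma spider_adj_par {n r : ℕ} (hr : 2 ≤ r) (v : Fin n) (hv : 1 ≤ v.val) :
    (spiderS n r).Adj v (spParF r v) := by
  rw [spider_adj]
  refine ⟨?_, Or.inl rfl⟩
  intro h
  have h1 := spPar_lt hr hv
  have h2 : v.val = spPar r v := congrArg Fin.val h
  omega

lemma spider_connected {n r : ℕ} (hr : 2 ≤ r) (hn : 1 ≤ n) : (spiderS n r).Connected := by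
  have key : ∀ (m : ℕ) (hm : m < n), (spiderS n r).Reachable ⟨m, hm⟩ ⟨0, hn⟩ := by
    intro m
    induction m using Nat.strong_induction_on with
    | _ m ih =>
      intro hm
      by_cases h0 : m = 0
      · subst h0; exact Reachable.refl _
      · have h1 : 1 ≤ m := by omega
        exact (spider_adj_par hr ⟨m, hm⟩ h1).reachable.trans (ih _ (spPar_lt hr h1) _)
  haveI : Nonempty (Fin n) := ⟨⟨0, hn⟩⟩
  exact ⟨fun a b => (key a a.2).trans (key b b.2).symm⟩

/-- Subtree hanging at v. -/
def spT {n : ℕ} (r : ℕ) (v : Fin n) : Set (Fin n) := {w | ∃ k : ℕ, w.val = v.val + k * r}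

lemma spT_cut {n r : ℕ} (v : Fin n) (hv : 1 ≤ v.val) (a b : Fin n)
    (hab : (spiderS n r).Adj a b) (ha : a ∈ spT r v) (hb : b ∉ spT r v) :
    a = v ∧ b = spParF r v := by
  rw [spider_adj] at hab
  obtain ⟨-, hab⟩ := hab
  obtain ⟨k, hk⟩ := ha
  have hav : a = v := by
    rcases hab with h | h
    · rcases k with _ | k
      · exact Fin.ext (by simpa using hk)
      · exfalso
        apply hb
        refine ⟨k, ?_⟩
        rw [Nat.succ_mul] at hk
        unfold spPar at h
        split_ifs at h <;> omega
    · exfalso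
      apply hb
      refine ⟨k + 1, ?_⟩
      rw [Nat.succ_mul]
      unfold spPar at h
      split_ifs at h <;> omega
  refine ⟨hav, ?_⟩
  subst hav
  rcases hab with h | h
  · exact Fin.ext h.symm
  · exfalso
    apply hb
    refine ⟨1, ?_⟩
    unfold spPar at h
    split_ifs at h <;> omega

lemma spT_card {n r : ℕ} (hr : 2 ≤ r) (v : Fin n) :
    (Finset.univ.filter fun w => w ∈ spT r v).card = (n - 1 - v.val) / r + 1 := by
  rw [← Finset.card_range ((n - 1 - v.val) / r + 1)]
  have hb : ∀ k, k < (n - 1 - v.val) / r + 1 ↔ v.val + k * r < n := by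
    intro k
    have := v.2
    rw [Nat.lt_succ_iff, Nat.le_div_iff_mul_le (by omega)]
    omega
  symm
  refine Finset.card_bij (fun k hk => ⟨v.val + k * r, (hb k).1 (Finset.mem_range.1 hk)⟩) ?_ ?_ ?_
  · intro k hk
    simp only [Finset.mem_filter, Finset.mem_univ, true_and]
    exact ⟨k, rfl⟩
  · intro a _ b _ h
    have h' : v.val + a * r = v.val + b * r := congrArg Fin.val h
    exact Nat.eq_of_mul_eq_mul_right (by omega : 0 < r) (by omega)
  · intro w hw
    simp only [Finset.mem_filter, Finset.mem_univ, true_and] at hw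
    obtain ⟨k, hk⟩ := hw
    exact ⟨k, Finset.mem_range.2 ((hb k).2 (hk ▸ w.2)), Fin.ext hk.symm⟩

lemma spider_psi {n r : ℕ} (hr : 2 ≤ r) (v : Fin n) (hv : 1 ≤ v.val) :
    mostarPsi (spiderS n r) s(v, spParF r v) = n - 2 * ((n - 1 - v.val) / r + 1) := by
  have hn := v.2
  have hG : (spiderS n r).Connected := spider_connected hr (by omega)
  have hvT : v ∈ spT r v := ⟨0, by simp⟩
  have hpT : spParF r v ∉ spT r v := by
    rintro ⟨k, hk⟩
    have h1 := spPar_lt hr hv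
    have h2 : spPar r v = v.val + k * r := hk
    have := Nat.zero_le (k * r)
    omega
  have hin : ∀ w, w ∈ spT r v →
      (spiderS n r).dist w v < (spiderS n r).dist w (spParF r v) := fun w hw =>
    dist_lt_of_cut hG (spT r v) hpT (fun a b => spT_cut v hv a b) hw
  have hout : ∀ w, w ∉ spT r v →
      (spiderS n r).dist w (spParF r v) < (spiderS n r).dist w v := fun w hw =>
    dist_lt_of_cut hG (spT r v)ᶜ (fun h => h hvT)
      (fun a b hab ha hb => (spT_cut v hv b a hab.symm (not_not.1 hb) ha).symm) hw
  have e1 : (Finset.univ.filter fun w =>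
      (spiderS n r).dist w v < (spiderS n r).dist w (spParF r v)) =
      Finset.univ.filter fun w => w ∈ spT r v := by
    ext w
    simp only [Finset.mem_filter, Finset.mem_univ, true_and]
    exact ⟨fun h => by by_contra h'; exact absurd (hout w h') (by omega), hin w⟩
  have e2 : (Finset.univ.filter fun w =>
      (spiderS n r).dist w (spParF r v) < (spiderS n r).dist w v) =
      Finset.univ.filter fun w => ¬ w ∈ spT r v := by
    ext w
    simp only [Finset.mem_filter, Finset.mem_univ, true_and]
    exact ⟨fun h h' => absurd (hin w h') (by omega), hout w⟩
  have hsum := Finset.card_filter_add_card_filter_not (s := (Finset.univ : Finset (Fin n)))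
    (fun w => w ∈ spT r v)
  rw [Finset.card_univ, Fintype.card_fin] at hsum
  have hc := spT_card hr v
  have hbound : (n - 1 - v.val) / r ≤ (n - 1 - v.val) / 2 := Nat.div_le_div_left hr (by norm_num)
  unfold mostarPsi
  rw [Sym2.lift_mk]
  dsimp only
  rw [e1, e2]
  omega

lemma spider_mostar {n r : ℕ} (hr : 2 ≤ r) :
    mostar (spiderS n r) = ∑ v ∈ (Finset.univ : Finset (Fin n)).filter (fun v => 1 ≤ v.val),
      (n - 2 * ((n - 1 - v.val) / r + 1)) := by
  unfold mostar
  symm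
  refine Finset.sum_bij (fun v _ => s(v, spParF r v)) ?_ ?_ ?_ ?_
  · intro v hv
    rw [SimpleGraph.mem_edgeFinset, SimpleGraph.mem_edgeSet]
    exact spider_adj_par hr v (Finset.mem_filter.1 hv).2
  · intro a ha b hb h
    have h1 := spPar_lt hr (Finset.mem_filter.1 ha).2
    have h2 := spPar_lt hr (Finset.mem_filter.1 hb).2
    rcases Sym2.eq_iff.1 h with ⟨h, -⟩ | ⟨h3, h4⟩
    · exact h
    · exfalso
      have h5 : a.val = spPar r b := congrArg Fin.val h3
      have h6 : spPar r a = b.val := congrArg Fin.val h4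
      omega
  · intro e
    induction e using Sym2.ind with
    | _ a b =>
      intro he
      rw [SimpleGraph.mem_edgeFinset, SimpleGraph.mem_edgeSet, spider_adj] at he
      obtain ⟨hne, h⟩ := he
      have hne' : a.val ≠ b.val := fun h => hne (Fin.ext h)
      rcases h with h | h
      · have := spPar_le r a
        refine ⟨a, Finset.mem_filter.2 ⟨Finset.mem_univ _, by omega⟩, ?_⟩
        rw [show spParF r a = b from Fin.ext h]
      · have := spPar_le r b
        refine ⟨b, Finset.mem_filter.2 ⟨Finset.mem_univ _, by omega⟩, ?_⟩
        rw [show spParF r b = a from Fin.ext h, Sym2.eq_swap]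
  · intro v hv
    exact (spider_psi hr v (Finset.mem_filter.1 hv).2).symm

/-- For 2 ≤ r ≤ n-2, Mo(S_{n,r}) < Mo(S_{n,r+1}). -/
theorem mostar_spiderS_lt_succ (n r : ℕ) (h1 : 2 ≤ r) (h2 : r ≤ n - 2) (hn : 4 ≤ n) :
    mostar (spiderS n r) < mostar (spiderS n (r + 1)) := by
  rw [spider_mostar h1, spider_mostar (by omega)]
  apply Finset.sum_lt_sum
  · intro v _
    have : (n - 1 - v.val) / (r + 1) ≤ (n - 1 - v.val) / r :=
      Nat.div_le_div_left (by omega) (by omega)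
    omega
  · refine ⟨⟨n - 1 - r, by omega⟩, Finset.mem_filter.2 ⟨Finset.mem_univ _, ?_⟩, ?_⟩
    · show 1 ≤ n - 1 - r
      omega
    · show n - 2 * ((n - 1 - (n - 1 - r)) / r + 1) < n - 2 * ((n - 1 - (n - 1 - r)) / (r + 1) + 1)
      rw [show n - 1 - (n - 1 - r) = r by omega, Nat.div_self (by omega),
        Nat.div_eq_of_lt (by omega)]
      omega
end

section
/- Let n and k be integers with 1 ≤ k ≤ ⌊n/2⌋, and let T be a tree of order n with exactly 2k vertices of odd degree that has the minimum Mostar index among all such trees. Then T is isomorphic to C_{n,⌈(k−1)/2⌉,⌊(k−1)/2⌋}. -/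
open Finset SimpleGraph

open scoped Classical

namespace MoAux
set_option linter.unusedSectionVars false
variable {V : Type*} [Fintype V]

/-- the side of u of the edge uv -/
noncomputable def sd (G : SimpleGraph V) (u v : V) : Finset V :=
  Finset.univ.filter fun w => G.dist w u < G.dist w v

noncomputable def Fs (G : SimpleGraph V) (u v : V) : ℕ := ∑ x ∈ sd G u v, G.dist x v

noncomputable def os (G : SimpleGraph V) (u v : V) : ℕ :=
  ∑ x ∈ sd G u v, if Odd (G.degree x) then 1 else 0

noncomputable def Ds (G : SimpleGraph V) (c : V) : ℕ := ∑ x, G.dist x c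

lemma mem_sd {G : SimpleGraph V} {u v w : V} : w ∈ sd G u v ↔ G.dist w u < G.dist w v := by
  simp [sd]

lemma exists_closer {G : SimpleGraph V} (hG : G.Connected) {x c : V} (h : x ≠ c) :
    ∃ w, G.Adj c w ∧ G.dist x c = G.dist x w + 1 := by
  obtain ⟨p, hp⟩ := hG.exists_walk_length_eq_dist c x
  cases p with
  | nil => exact absurd rfl h
  | @cons _ w _ hadj q =>
    refine ⟨w, hadj, ?_⟩
    have h1 : G.dist w x ≤ q.length := dist_le q
    have h2 := hG.dist_triangle (u := c) (v := w) (w := x)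
    have h3 : G.dist c w = 1 := dist_eq_one_iff_adj.2 hadj
    rw [Walk.length_cons] at hp
    rw [dist_comm (u := x) (v := c), dist_comm (u := x) (v := w)]
    omega

lemma closer_unique {G : SimpleGraph V} (hG : G.IsTree) {x c w w' : V} (h : G.Adj c w)
    (h' : G.Adj c w') (hd : G.dist x w < G.dist x c) (hd' : G.dist x w' < G.dist x c) :
    w = w' := by
  have key : ∀ z, (hz : G.Adj c z) → G.dist x z < G.dist x c →
      ∃ p : G.Walk z x, (Walk.cons hz p).IsPath := by
    intro z hz hdz
    obtain ⟨p, hp⟩ := hG.connected.exists_walk_length_eq_dist z x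
    refine ⟨p, ?_⟩
    apply Walk.isPath_of_length_eq_dist
    rcases hG.dist_eq_dist_add_one_of_adj x hz with h1 | h1
    · rw [Walk.length_cons, hp, dist_comm (u := c), h1, dist_comm (u := z)]
    · omega
  obtain ⟨p, hp⟩ := key w h hd
  obtain ⟨q, hq⟩ := key w' h' hd'
  have := (hG.existsUnique_path c x).unique hp hq
  have h2 := congrArg Walk.snd this
  simpa using h2

lemma dist_of_mem {G : SimpleGraph V} (hG : G.IsTree) {u v x : V} (h : G.Adj u v)
    (hx : x ∈ sd G u v) : G.dist x v = G.dist x u + 1 := by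
  rw [mem_sd] at hx
  rcases hG.dist_eq_dist_add_one_of_adj x h with h1 | h1 <;> omega

lemma mem_sd_compl {G : SimpleGraph V} (hG : G.IsTree) {u v x : V} (h : G.Adj u v) :
    x ∈ sd G v u ↔ x ∉ sd G u v := by
  rw [mem_sd, mem_sd]
  have := hG.dist_ne_of_adj x h
  omega

lemma self_mem_sd {G : SimpleGraph V} {u v : V} (h : G.Adj u v) : u ∈ sd G u v := by
  rw [mem_sd, dist_self, dist_eq_one_iff_adj.2 h]; omega

lemma sum_univ_side {G : SimpleGraph V} (hG : G.IsTree) (c : V) {M : Type*} [AddCommMonoid M]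
    (f : V → M) :
    ∑ x, f x = f c + ∑ w ∈ G.neighborFinset c, ∑ x ∈ sd G w c, f x := by
  rw [← Finset.sum_biUnion, ← Finset.add_sum_erase _ f (Finset.mem_univ c)]
  · congr 1
    apply Finset.sum_congr _ (fun _ _ => rfl)
    ext x
    simp only [mem_erase, mem_univ, and_true, mem_biUnion, mem_neighborFinset, mem_sd]
    constructor
    · intro hx
      obtain ⟨w, hw, hd⟩ := exists_closer hG.connected hx
      exact ⟨w, hw, by omega⟩
    · rintro ⟨w, hw, hd⟩ rfl
      simp at hd
  · intro w hw w' hw' hne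
    simp only [coe_neighborFinset, mem_neighborSet] at hw hw'
    simp only [Function.onFun]
    rw [Finset.disjoint_left]
    intro x hx hx'
    rw [mem_sd] at hx hx'
    exact hne (closer_unique hG hw hw' hx hx')

lemma sum_split {G : SimpleGraph V} (hG : G.IsTree) {u v : V} (h : G.Adj u v)
    {M : Type*} [AddCommMonoid M] (f : V → M) :
    ∑ x, f x = ∑ x ∈ sd G u v, f x + ∑ x ∈ sd G v u, f x := by
  rw [← Finset.sum_add_sum_compl (sd G u v)]
  congr 1
  apply Finset.sum_congr _ (fun _ _ => rfl)
  ext x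
  rw [mem_compl, mem_sd_compl hG h]

lemma sum_side {G : SimpleGraph V} (hG : G.IsTree) {u v : V} (h : G.Adj u v) (f : V → ℤ) :
    ∑ x ∈ sd G u v, f x =
      f u + ∑ w ∈ (G.neighborFinset u).erase v, ∑ x ∈ sd G w u, f x := by
  have h1 := sum_univ_side hG u f
  have h2 := sum_split hG h f
  have h3 := Finset.add_sum_erase (G.neighborFinset u) (fun w => ∑ x ∈ sd G w u, f x)
    ((mem_neighborFinset _ _ _).2 h)
  linarith

lemma sum_side_nat {G : SimpleGraph V} (hG : G.IsTree) {u v : V} (h : G.Adj u v) (f : V → ℕ) :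
    ∑ x ∈ sd G u v, f x =
      f u + ∑ w ∈ (G.neighborFinset u).erase v, ∑ x ∈ sd G w u, f x := by
  have := sum_side hG h (fun x => (f x : ℤ))
  exact_mod_cast this

lemma card_side {G : SimpleGraph V} (hG : G.IsTree) {u v : V} (h : G.Adj u v) :
    (sd G u v).card = 1 + ∑ w ∈ (G.neighborFinset u).erase v, (sd G w u).card := by
  have := sum_side_nat hG h (fun _ => 1)
  simpa using this

lemma os_side {G : SimpleGraph V} (hG : G.IsTree) {u v : V} (h : G.Adj u v) :
    os G u v = (if Odd (G.degree u) then 1 else 0) +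
      ∑ w ∈ (G.neighborFinset u).erase v, os G w u :=
  sum_side_nat hG h _

lemma Fs_eq {G : SimpleGraph V} (hG : G.IsTree) {u v : V} (h : G.Adj u v) :
    Fs G u v = (sd G u v).card + ∑ x ∈ sd G u v, G.dist x u := by
  unfold Fs
  rw [Finset.sum_congr rfl (fun x hx => dist_of_mem hG h hx), Finset.sum_add_distrib]
  simp [add_comm]

lemma Fs_side {G : SimpleGraph V} (hG : G.IsTree) {u v : V} (h : G.Adj u v) :
    Fs G u v = (sd G u v).card + ∑ w ∈ (G.neighborFinset u).erase v, Fs G w u := by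
  rw [Fs_eq hG h, sum_side_nat hG h]
  simp [Fs]

lemma Ds_eq {G : SimpleGraph V} (hG : G.IsTree) (c : V) :
    Ds G c = ∑ w ∈ G.neighborFinset c, Fs G w c := by
  unfold Ds
  rw [sum_univ_side hG c]
  simp [Fs]

lemma card_root {G : SimpleGraph V} (hG : G.IsTree) (c : V) :
    Fintype.card V = 1 + ∑ w ∈ G.neighborFinset c, (sd G w c).card := by
  have := sum_univ_side hG c (fun _ => (1:ℕ))
  simpa using this

lemma odd_root {G : SimpleGraph V} (hG : G.IsTree) (c : V) :
    oddDegreeCount G = (if Odd (G.degree c) then 1 else 0) +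
      ∑ w ∈ G.neighborFinset c, os G w c := by
  have := sum_univ_side hG c (fun x => if Odd (G.degree x) then (1:ℕ) else 0)
  unfold oddDegreeCount
  rw [Finset.card_filter]
  exact this

lemma card_split {G : SimpleGraph V} (hG : G.IsTree) {u v : V} (h : G.Adj u v) :
    Fintype.card V = (sd G u v).card + (sd G v u).card := by
  have := sum_split hG h (fun _ => (1:ℕ))
  simpa using this

lemma odd_split {G : SimpleGraph V} (hG : G.IsTree) {u v : V} (h : G.Adj u v) :
    oddDegreeCount G = os G u v + os G v u := by
  have := sum_split hG h (fun x => if Odd (G.degree x) then (1:ℕ) else 0)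
  unfold oddDegreeCount
  rw [Finset.card_filter]
  exact this

lemma os_le (G : SimpleGraph V) (u v : V) : os G u v ≤ (sd G u v).card := by
  unfold os
  rw [← Finset.card_filter]
  exact Finset.card_filter_le _ _

lemma Ds_diff {G : SimpleGraph V} (hG : G.IsTree) {u v : V} (h : G.Adj u v) :
    Ds G v + (sd G v u).card = Ds G u + (sd G u v).card := by
  have e1 : Ds G u = ∑ x ∈ sd G u v, G.dist x u + ∑ x ∈ sd G v u, G.dist x u := sum_split hG h _
  have e2 : Ds G v = ∑ x ∈ sd G u v, G.dist x v + ∑ x ∈ sd G v u, G.dist x v := sum_split hG h _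
  have f1 := Fs_eq hG h
  have f2 := Fs_eq hG h.symm
  unfold Fs at f1 f2
  omega

lemma child_card_lt {G : SimpleGraph V} (hG : G.IsTree) {u v w : V} (h : G.Adj u v)
    (hw : w ∈ (G.neighborFinset u).erase v) : (sd G w u).card < (sd G u v).card := by
  rw [card_side hG h]
  have := Finset.single_le_sum (f := fun w => (sd G w u).card) (fun _ _ => Nat.zero_le _) hw
  omega

lemma child_adj {G : SimpleGraph V} {u v w : V}
    (hw : w ∈ (G.neighborFinset u).erase v) : G.Adj w u := by
  simp at hw; exact hw.2.symm

/-- induction over directed edges -/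
lemma side_induction {G : SimpleGraph V} (hG : G.IsTree) (P : V → V → Prop)
    (step : ∀ u v, G.Adj u v → (∀ w ∈ (G.neighborFinset u).erase v, P w u) → P u v) :
    ∀ u v, G.Adj u v → P u v := by
  have : ∀ n u v, G.Adj u v → (sd G u v).card = n → P u v := by
    intro n
    induction n using Nat.strong_induction_on with
    | _ n ih =>
      intro u v h hn
      apply step u v h
      intro w hw
      exact ih _ (hn ▸ child_card_lt hG h hw) w u (child_adj hw) rfl
  intro u v h
  exact this _ u v h rfl

lemma card_children {G : SimpleGraph V} {u v : V} (h : G.Adj u v) :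
    ((G.neighborFinset u).erase v).card + 1 = G.degree u := by
  rw [Finset.card_erase_add_one ((mem_neighborFinset _ _ _).2 h), card_neighborFinset_eq_degree]

lemma os_odd {G : SimpleGraph V} (hG : G.IsTree) : ∀ u v, G.Adj u v → Odd (os G u v) := by
  apply side_induction hG
  intro u v h ih
  rw [os_side hG h]
  have h1 := card_children h
  rw [← h1]
  have h2 := Finset.odd_sum_iff_odd_card_odd (s := (G.neighborFinset u).erase v) (fun w => os G w u)
  rw [Finset.filter_true_of_mem ih] at h2
  rcases Nat.even_or_odd ((G.neighborFinset u).erase v).card with h3 | h3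
  · rw [if_pos (Even.add_one h3)]
    rw [← Nat.not_even_iff_odd, ← Nat.not_even_iff_odd] at h2
    have := not_not.1 (mt h2.1 (not_not.2 h3))
    exact this.one_add
  · rw [if_neg (Nat.not_odd_iff_even.2 (Odd.add_one h3)), zero_add]
    exact h2.2 h3

end MoAux

namespace MoAux
set_option linter.unusedSectionVars false
variable {V : Type*} [Fintype V]

lemma parent_exists {G : SimpleGraph V} (hG : G.IsTree) (c : V) :
    ∃ p : V → V, ∀ y, y ≠ c → G.Adj y (p y) ∧ G.dist c y = G.dist c (p y) + 1 := by
  have : ∀ y, ∃ z, y ≠ c → G.Adj y z ∧ G.dist c y = G.dist c z + 1 := by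
    intro y
    by_cases h : y = c
    · exact ⟨y, fun h' => absurd h h'⟩
    · obtain ⟨w, hw⟩ := exists_closer hG.connected (x := c) (c := y) (fun e => h e.symm)
      exact ⟨w, fun _ => hw⟩
  choose p hp using this
  exact ⟨p, hp⟩

lemma parent_eq {G : SimpleGraph V} (hG : G.IsTree) {c : V} {p : V → V}
    (hp : ∀ y, y ≠ c → G.Adj y (p y) ∧ G.dist c y = G.dist c (p y) + 1) {u v : V}
    (h : G.Adj u v) (hc : c ∉ sd G u v) : u ≠ c ∧ p u = v := by
  have hne : u ≠ c := by rintro rfl; exact hc (self_mem_sd h)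
  refine ⟨hne, ?_⟩
  have h1 := hp u hne
  have h2 := (mem_sd_compl hG h).2 hc
  rw [mem_sd] at h2
  exact closer_unique hG h1.1 h (by omega) h2

lemma not_mem_child {G : SimpleGraph V} (hG : G.IsTree) {c u v w : V}
    (h : G.Adj u v) (hc : c ∉ sd G u v) (hw : w ∈ (G.neighborFinset u).erase v) :
    c ∉ sd G w u := by
  intro h1
  have h2 := (mem_sd_compl hG h).2 hc
  rw [mem_sd] at h1 h2
  have := closer_unique hG (child_adj hw).symm h h1 h2
  simp [this] at hw

lemma sum_sizes_side {G : SimpleGraph V} (hG : G.IsTree) {c : V} {p : V → V}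
    (hp : ∀ y, y ≠ c → G.Adj y (p y) ∧ G.dist c y = G.dist c (p y) + 1) :
    ∀ u v, G.Adj u v → c ∉ sd G u v →
      ∑ y ∈ sd G u v, (sd G y (p y)).card = Fs G u v := by
  apply side_induction hG
  intro u v h ih hc
  rw [sum_side_nat hG h, Fs_side hG h, (parent_eq hG hp h hc).2]
  congr 1
  apply Finset.sum_congr rfl
  intro w hw
  exact ih w hw (not_mem_child hG h hc hw)

lemma sum_sizes {G : SimpleGraph V} (hG : G.IsTree) {c : V} {p : V → V}
    (hp : ∀ y, y ≠ c → G.Adj y (p y) ∧ G.dist c y = G.dist c (p y) + 1) :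
    ∑ y ∈ Finset.univ.erase c, (sd G y (p y)).card = Ds G c := by
  have h1 := sum_univ_side hG c (fun y => (sd G y (p y)).card)
  have h2 := Finset.add_sum_erase Finset.univ (fun y => (sd G y (p y)).card) (Finset.mem_univ c)
  have h3 : ∑ w ∈ G.neighborFinset c, ∑ x ∈ sd G w c, (sd G x (p x)).card = Ds G c := by
    rw [Ds_eq hG]
    apply Finset.sum_congr rfl
    intro w hw
    apply sum_sizes_side hG hp w c ((mem_neighborFinset _ _ _).1 hw).symm
    rw [mem_sd]; simp
  omega

lemma mostar_sum {G : SimpleGraph V} (hG : G.IsTree) {c : V} {p : V → V}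
    (hp : ∀ y, y ≠ c → G.Adj y (p y) ∧ G.dist c y = G.dist c (p y) + 1) :
    mostar G = ∑ y ∈ Finset.univ.erase c,
      (((sd G y (p y)).card : ℤ) - ((sd G (p y) y).card : ℤ)).natAbs := by
  have himg : G.edgeFinset = (Finset.univ.erase c).image (fun y => s(y, p y)) := by
    ext e
    induction e using Sym2.ind with
    | _ u v =>
      rw [mem_edgeFinset, mem_edgeSet]
      simp only [mem_image, mem_erase, mem_univ, and_true]
      constructor
      · intro h
        by_cases hc : c ∈ sd G u v
        · have h1 : c ∉ sd G v u := by rw [mem_sd_compl hG h]; simpa using hc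
          have := parent_eq hG hp h.symm h1
          exact ⟨v, this.1, by rw [this.2]; exact Sym2.eq_swap⟩
        · have := parent_eq hG hp h hc
          exact ⟨u, this.1, by rw [this.2]⟩
      · rintro ⟨y, hy, he⟩
        have := (hp y hy).1
        rw [← mem_edgeSet, ← he]
        exact this
  unfold mostar
  have hinj : Set.InjOn (fun y => s(y, p y)) ((Finset.univ.erase c : Finset V) : Set V) := by
    intro y hy z hz he
    simp only [coe_erase, coe_univ, Set.mem_diff, Set.mem_univ, Set.mem_singleton_iff, true_and]
      at hy hz
    rw [Sym2.eq_iff] at he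
    rcases he with h | h
    · exact h.1
    · have h1 := (hp y hy).2
      have h2 := (hp z hz).2
      rw [h.2] at h1
      rw [← h.1] at h2
      omega
  have : ∑ e ∈ G.edgeFinset, mostarPsi G e
      = ∑ e ∈ (Finset.univ.erase c).image (fun y => s(y, p y)), mostarPsi G e := by
    rw [← himg]
  rw [this, Finset.sum_image hinj]
  rfl

lemma mostar_ge {G : SimpleGraph V} (hG : G.IsTree) (c : V) :
    (Fintype.card V : ℤ) * (Fintype.card V - 1) - 2 * Ds G c ≤ mostar G := by
  obtain ⟨p, hp⟩ := parent_exists hG c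
  rw [mostar_sum hG hp, ← sum_sizes hG hp]
  push_cast
  have h0 : (∑ y ∈ (Finset.univ.erase c : Finset V), (Fintype.card V : ℤ))
      = (Fintype.card V : ℤ) * (Fintype.card V - 1) := by
    rw [Finset.sum_const, Finset.card_erase_of_mem (Finset.mem_univ _), Finset.card_univ]
    have : 1 ≤ Fintype.card V := Fintype.card_pos_iff.2 ⟨c⟩
    rw [nsmul_eq_mul, Nat.cast_sub this]; push_cast; ring
  rw [← h0, Finset.mul_sum, ← Finset.sum_sub_distrib]
  apply Finset.sum_le_sum
  intro y hy
  have h1 := card_split hG (hp y (Finset.ne_of_mem_erase hy)).1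
  rw [h1]; push_cast
  have := neg_abs_le (((sd G y (p y)).card : ℤ) - (sd G (p y) y).card)
  linarith

lemma small_sides {G : SimpleGraph V} (hG : G.IsTree) {c : V}
    (hc : ∀ w, G.Adj w c → 2 * (sd G w c).card ≤ Fintype.card V) :
    ∀ u v, G.Adj u v → c ∉ sd G u v → 2 * (sd G u v).card ≤ Fintype.card V := by
  obtain ⟨p, hp⟩ := parent_exists hG c
  have : ∀ m u v, G.dist c u = m → G.Adj u v → c ∉ sd G u v →
      2 * (sd G u v).card ≤ Fintype.card V := by
    intro m
    induction m with
    | zero =>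
      intro u v h0 h hcu
      have := parent_eq hG hp h hcu
      have := hG.connected.dist_eq_zero_iff.1 h0
      exact absurd this.symm (parent_eq hG hp h hcu).1
    | succ m ih =>
      intro u v h0 h hcu
      by_cases hv : v = c
      · subst hv; exact hc u h
      · have h1 := parent_eq hG hp h hcu
        have h2 := hp u h1.1
        have h3 := hp v hv
        rw [h1.2] at h2
        have h4 : c ∉ sd G v (p v) := by rw [mem_sd]; omega
        have h5 := ih v (p v) (by omega) h3.1 h4
        have h6 : u ∈ (G.neighborFinset v).erase (p v) := by
          simp only [mem_erase, mem_neighborFinset]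
          refine ⟨?_, h.symm⟩
          intro e
          rw [← e] at h3
          omega
        have := child_card_lt hG h3.1 h6
        omega
  intro u v
  exact this _ u v rfl

lemma mostar_eq {G : SimpleGraph V} (hG : G.IsTree) {c : V}
    (hc : ∀ w, G.Adj w c → 2 * (sd G w c).card ≤ Fintype.card V) :
    (mostar G : ℤ) = (Fintype.card V : ℤ) * (Fintype.card V - 1) - 2 * Ds G c := by
  obtain ⟨p, hp⟩ := parent_exists hG c
  rw [mostar_sum hG hp, ← sum_sizes hG hp]
  push_cast
  have h0 : (∑ y ∈ (Finset.univ.erase c : Finset V), (Fintype.card V : ℤ))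
      = (Fintype.card V : ℤ) * (Fintype.card V - 1) := by
    rw [Finset.sum_const, Finset.card_erase_of_mem (Finset.mem_univ _), Finset.card_univ]
    have : 1 ≤ Fintype.card V := Fintype.card_pos_iff.2 ⟨c⟩
    rw [nsmul_eq_mul, Nat.cast_sub this]; push_cast; ring
  rw [← h0, Finset.mul_sum, ← Finset.sum_sub_distrib]
  apply Finset.sum_congr rfl
  intro y hy
  have h2 := hp y (Finset.ne_of_mem_erase hy)
  have h1 := card_split hG h2.1
  have h3 := small_sides hG hc y (p y) h2.1 (by rw [mem_sd]; omega)
  rw [abs_of_nonpos (by omega)]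
  rw [h1]; push_cast; ring

/-- a vertex minimizing the transmission is a centroid -/
lemma centroid {G : SimpleGraph V} (hG : G.IsTree) :
    ∃ c, ∀ w, G.Adj w c → 2 * (sd G w c).card ≤ Fintype.card V := by
  have : Nonempty V := hG.connected.nonempty
  obtain ⟨c, -, hc⟩ := Finset.exists_min_image (Finset.univ : Finset V) (Ds G) Finset.univ_nonempty
  refine ⟨c, fun w hw => ?_⟩
  have h1 := hc w (Finset.mem_univ _)
  have h2 := Ds_diff hG hw
  have h3 := card_split hG hw
  omega

/-- cut lemma -/
lemma cut_dist {G : SimpleGraph V} (hG : G.Connected) {u v : V} (S : V → Prop) (hv : ¬ S v)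
    (hadj : G.Adj u v)
    (hcut : ∀ x y, S x → ¬ S y → G.Adj x y → x = u ∧ y = v) :
    ∀ x, S x → G.dist x u < G.dist x v := by
  have : ∀ m x, G.dist x v = m → S x → G.dist x u < G.dist x v := by
    intro m
    induction m with
    | zero =>
      intro x h0 hx
      have := hG.dist_eq_zero_iff.1 h0
      subst this; exact absurd hx hv
    | succ m ih =>
      intro x h0 hx
      have hxv : v ≠ x := by rintro rfl; exact hv hx
      obtain ⟨w, hw, hd⟩ := exists_closer hG hxv
      rw [dist_comm (u := v), dist_comm (u := v)] at hd
      by_cases hSw : S w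
      · have h1 := ih w (by omega) hSw
        have h2 := hG.dist_triangle (u := x) (v := w) (w := u)
        have h3 : G.dist x w = 1 := dist_eq_one_iff_adj.2 hw
        omega
      · obtain ⟨rfl, rfl⟩ := hcut x w hx hSw hw
        exact mem_sd.1 (self_mem_sd hadj)
  intro x
  exact this _ x rfl

lemma lipschitz_dist {G : SimpleGraph V} (hG : G.Connected) (h : V → ℤ)
    (hl : ∀ x y, G.Adj x y → h x ≤ h y + 1) (x c : V) : h x - h c ≤ G.dist x c := by
  obtain ⟨p, hp⟩ := hG.exists_walk_length_eq_dist x c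
  rw [← hp]
  clear hp
  induction p with
  | nil => simp
  | cons hadj q ih =>
    have := hl _ _ hadj
    rw [Walk.length_cons]; push_cast; linarith

end MoAux

namespace MoAux
set_option linter.unusedSectionVars false
variable {V : Type*} [Fintype V]

def bd (s o : ℤ) : ℤ := 2 * s ^ 2 + 2 * s - (o - 1) ^ 2

lemma step_num_big {ι : Type*} (C : Finset ι) (s o : ι → ℤ) (h1 : ∀ i ∈ C, 1 ≤ o i)
    (h2 : ∀ i ∈ C, o i ≤ s i) (hm : 3 ≤ C.card) :
    4 * (1 + ∑ i ∈ C, s i) + ∑ i ∈ C, bd (s i) (o i) <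
      bd (1 + ∑ i ∈ C, s i) ((if Even C.card then 1 else 0) + ∑ i ∈ C, o i) := by
  set S := ∑ i ∈ C, s i with hS
  set O := ∑ i ∈ C, o i with hO
  have hA : ∑ i ∈ C, o i * (O - o i) ≤ ∑ i ∈ C, s i * (S - s i) := by
    apply Finset.sum_le_sum
    intro i hi
    have e1 : S - s i = ∑ j ∈ C.erase i, s j := by
      rw [hS, ← Finset.add_sum_erase C s hi]; ring
    have e2 : O - o i = ∑ j ∈ C.erase i, o j := by
      rw [hO, ← Finset.add_sum_erase C o hi]; ring
    have h3 : O - o i ≤ S - s i := by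
      rw [e1, e2]
      exact Finset.sum_le_sum (fun j hj => h2 j (Finset.mem_of_mem_erase hj))
    have h4 : 0 ≤ O - o i := by
      rw [e2]
      exact Finset.sum_nonneg (fun j hj => by linarith [h1 j (Finset.mem_of_mem_erase hj)])
    have := h1 i hi
    have := h2 i hi
    nlinarith
  have hB : ∑ i ∈ C, o i * ((C.card : ℤ) - 1) ≤ ∑ i ∈ C, o i * (O - o i) := by
    apply Finset.sum_le_sum
    intro i hi
    have e2 : O - o i = ∑ j ∈ C.erase i, o j := by
      rw [hO, ← Finset.add_sum_erase C o hi]; ring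
    have h3 : ∑ j ∈ C.erase i, (1:ℤ) ≤ O - o i := by
      rw [e2]
      exact Finset.sum_le_sum (fun j hj => h1 j (Finset.mem_of_mem_erase hj))
    rw [Finset.sum_const, Finset.card_erase_of_mem hi, nsmul_eq_mul, mul_one,
      Nat.cast_sub (by omega)] at h3
    push_cast at h3
    have := h1 i hi
    nlinarith
  have hC : (C.card : ℤ) ≤ O := by
    have : ∑ j ∈ C, (1:ℤ) ≤ O := Finset.sum_le_sum h1
    simpa using this
  have eA1 : ∑ i ∈ C, o i * (O - o i) = O * O - ∑ i ∈ C, o i ^ 2 := by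
    rw [hO, Finset.sum_mul, ← Finset.sum_sub_distrib]
    apply Finset.sum_congr rfl; intro i _; ring
  have eA2 : ∑ i ∈ C, s i * (S - s i) = S * S - ∑ i ∈ C, s i ^ 2 := by
    rw [hS, Finset.sum_mul, ← Finset.sum_sub_distrib]
    apply Finset.sum_congr rfl; intro i _; ring
  have eB : ∑ i ∈ C, o i * ((C.card : ℤ) - 1) = O * ((C.card : ℤ) - 1) := by
    rw [hO, Finset.sum_mul]
  have eC : ∑ i ∈ C, bd (s i) (o i) =
      2 * ∑ i ∈ C, s i ^ 2 + 2 * S - ∑ i ∈ C, o i ^ 2 + 2 * O - C.card := by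
    have : (C.card : ℤ) = ∑ i ∈ C, (1:ℤ) := by simp
    rw [hS, hO, this, Finset.mul_sum, Finset.mul_sum, Finset.mul_sum,
      ← Finset.sum_add_distrib, ← Finset.sum_sub_distrib, ← Finset.sum_add_distrib,
      ← Finset.sum_sub_distrib]
    apply Finset.sum_congr rfl; intro i _; unfold bd; ring
  rw [eA1] at hA hB
  rw [eA2] at hA
  rw [eB] at hB
  rw [eC]
  generalize (∑ i ∈ C, o i ^ 2) = o2 at *
  generalize (∑ i ∈ C, s i ^ 2) = s2 at *
  have hm' : (3:ℤ) ≤ C.card := by exact_mod_cast hm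
  generalize hmm : (C.card : ℤ) = m at *
  unfold bd
  split_ifs with he
  · have : (4:ℤ) ≤ m := by
      rcases he with ⟨r, hr⟩
      omega
    nlinarith
  · nlinarith

lemma os_pos {G : SimpleGraph V} (hG : G.IsTree) {u v : V} (h : G.Adj u v) : 1 ≤ os G u v := by
  obtain ⟨r, hr⟩ := os_odd hG u v h
  omega

lemma step_sides {G : SimpleGraph V} (hG : G.IsTree) {u v : V} (h : G.Adj u v) :
    ((sd G u v).card : ℤ) = 1 + ∑ w ∈ (G.neighborFinset u).erase v, ((sd G w u).card : ℤ) ∧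
    (os G u v : ℤ) = (if Even ((G.neighborFinset u).erase v).card then 1 else 0) +
      ∑ w ∈ (G.neighborFinset u).erase v, (os G w u : ℤ) ∧
    (4 * Fs G u v : ℤ) = 4 * (sd G u v).card +
      ∑ w ∈ (G.neighborFinset u).erase v, 4 * (Fs G w u : ℤ) := by
  refine ⟨?_, ?_, ?_⟩
  · rw [card_side hG h]; push_cast; ring
  · rw [os_side hG h, ← card_children h]
    have : Odd (((G.neighborFinset u).erase v).card + 1) ↔
      Even ((G.neighborFinset u).erase v).card := by
      rw [Nat.odd_add_one, Nat.not_odd_iff_even]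
    simp only [this]
    push_cast; rfl
  · rw [Fs_side hG h]; push_cast; rw [mul_add, Finset.mul_sum]

lemma num_two (s1 s2 o1 o2 : ℤ) (h1 : 1 ≤ o1) (h2 : 1 ≤ o2) (h3 : o1 ≤ s1) (h4 : o2 ≤ s2) :
    4 * (1 + (s1 + s2)) + (bd s1 o1 + bd s2 o2) ≤ bd (1 + (s1 + s2)) (1 + (o1 + o2)) ∧
    (4 * (1 + (s1 + s2)) + (bd s1 o1 + bd s2 o2) = bd (1 + (s1 + s2)) (1 + (o1 + o2)) →
      s1 = o1 ∧ s2 = o2 ∧ (o1 = 1 ∨ o2 = 1)) := by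
  have key : bd (1 + (s1 + s2)) (1 + (o1 + o2)) - (4 * (1 + (s1 + s2)) + (bd s1 o1 + bd s2 o2))
      = 4 * (s1 - o1) * s2 + 4 * o1 * (s2 - o2) + 2 * ((o1 - 1) * (o2 - 1)) := by
    unfold bd; ring
  have k1 : 0 ≤ (s1 - o1) * s2 := mul_nonneg (by linarith) (by linarith)
  have k2 : 0 ≤ o1 * (s2 - o2) := mul_nonneg (by linarith) (by linarith)
  have k3 : 0 ≤ (o1 - 1) * (o2 - 1) := mul_nonneg (by linarith) (by linarith)
  refine ⟨by nlinarith, fun he => ?_⟩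
  have z1 : (s1 - o1) * s2 = 0 := by nlinarith
  have z2 : o1 * (s2 - o2) = 0 := by nlinarith
  have z3 : (o1 - 1) * (o2 - 1) = 0 := by nlinarith
  refine ⟨?_, ?_, ?_⟩
  · rcases mul_eq_zero.1 z1 with h | h <;> linarith
  · rcases mul_eq_zero.1 z2 with h | h <;> linarith
  · rcases mul_eq_zero.1 z3 with h | h
    · left; linarith
    · right; linarith

/-- upper bound for the depth sum of a side -/
theorem Fs_le {G : SimpleGraph V} (hG : G.IsTree) : ∀ u v, G.Adj u v →
    (4 * Fs G u v : ℤ) ≤ bd (sd G u v).card (os G u v) := by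
  apply side_induction hG
  intro u v h ih
  obtain ⟨e1, e2, e3⟩ := step_sides hG h
  have hle := Finset.sum_le_sum ih
  have hp : ∀ w ∈ (G.neighborFinset u).erase v, (1:ℤ) ≤ os G w u := fun w hw => by
    exact_mod_cast os_pos hG (child_adj hw)
  have hs : ∀ w ∈ (G.neighborFinset u).erase v, (os G w u : ℤ) ≤ (sd G w u).card := fun w _ => by
    exact_mod_cast os_le G w u
  rw [e3, e1, e2]
  generalize (G.neighborFinset u).erase v = C at *
  rcases Nat.lt_or_ge C.card 3 with hc | hc
  · interval_cases hcc : C.card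
    · rw [Finset.card_eq_zero] at hcc
      subst hcc; simp [bd]
    · obtain ⟨w, rfl⟩ := Finset.card_eq_one.1 hcc
      simp only [Finset.sum_singleton] at *
      simp only [bd, Nat.not_even_one, if_false] at *
      linarith
    · obtain ⟨w1, w2, hne, rfl⟩ := Finset.card_eq_two.1 hcc
      simp only [Finset.sum_pair hne] at *
      have := (num_two _ _ _ _ (hp w1 (by simp)) (hp w2 (by simp)) (hs w1 (by simp))
        (hs w2 (by simp))).1
      simp only [even_two, if_true]
      linarith
  · have := step_num_big C _ _ hp hs hc
    linarith

def Ext (G : SimpleGraph V) (u v : V) : Prop :=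
  (4 * Fs G u v : ℤ) = bd (sd G u v).card (os G u v)

theorem ext_cases {G : SimpleGraph V} (hG : G.IsTree) {u v : V} (h : G.Adj u v)
    (hE : Ext G u v) :
    (∀ w ∈ (G.neighborFinset u).erase v, Ext G w u) ∧
    ((G.neighborFinset u).erase v = ∅ ∨ (∃ w, (G.neighborFinset u).erase v = {w}) ∨
      (∃ w1 w2, w1 ≠ w2 ∧ (G.neighborFinset u).erase v = {w1, w2} ∧
        (sd G w1 u).card = os G w1 u ∧ (sd G w2 u).card = 1 ∧ os G w2 u = 1)) := by
  obtain ⟨e1, e2, e3⟩ := step_sides hG h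
  have ih : ∀ w ∈ (G.neighborFinset u).erase v,
    (4 * Fs G w u : ℤ) ≤ bd (sd G w u).card (os G w u) := fun w hw => Fs_le hG w u (child_adj hw)
  have hle := Finset.sum_le_sum ih
  have hp : ∀ w ∈ (G.neighborFinset u).erase v, (1:ℤ) ≤ os G w u := fun w hw => by
    exact_mod_cast os_pos hG (child_adj hw)
  have hs : ∀ w ∈ (G.neighborFinset u).erase v, (os G w u : ℤ) ≤ (sd G w u).card := fun w _ => by
    exact_mod_cast os_le G w u
  unfold Ext at hE
  rw [e3, e1, e2] at hE
  generalize (G.neighborFinset u).erase v = C at *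
  rcases Nat.lt_or_ge C.card 3 with hc | hc
  · interval_cases hcc : C.card
    · rw [Finset.card_eq_zero] at hcc
      subst hcc; simp
    · obtain ⟨w, rfl⟩ := Finset.card_eq_one.1 hcc
      refine ⟨?_, Or.inr (Or.inl ⟨w, rfl⟩)⟩
      simp only [Finset.sum_singleton, Finset.mem_singleton, forall_eq] at *
      unfold Ext
      simp only [bd, Nat.not_even_one, if_false] at *
      linarith
    · obtain ⟨w1, w2, hne, rfl⟩ := Finset.card_eq_two.1 hcc
      simp only [Finset.sum_pair hne] at *
      obtain ⟨n1, n2⟩ := num_two _ _ _ _ (hp w1 (by simp)) (hp w2 (by simp)) (hs w1 (by simp))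
        (hs w2 (by simp))
      simp only [even_two, if_true] at hE
      have i1 := ih w1 (by simp)
      have i2 := ih w2 (by simp)
      obtain ⟨a1, a2, a3⟩ := n2 (by linarith)
      refine ⟨?_, Or.inr (Or.inr ?_)⟩
      · intro w hw
        simp only [mem_insert, mem_singleton] at hw
        unfold Ext
        rcases hw with rfl | rfl <;> linarith
      · have b1 : (sd G w1 u).card = os G w1 u := by exact_mod_cast a1
        have b2 : (sd G w2 u).card = os G w2 u := by exact_mod_cast a2
        rcases a3 with a3 | a3
        · have b3 : os G w1 u = 1 := by exact_mod_cast a3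
          exact ⟨w2, w1, hne.symm, Finset.pair_comm _ _, b2, by omega, b3⟩
        · have b3 : os G w2 u = 1 := by exact_mod_cast a3
          exact ⟨w1, w2, hne, rfl, b1, by omega, b3⟩
  · have := step_num_big C _ _ hp hs hc
    linarith

/-- shape of extremal sides -/
theorem ext_shape {G : SimpleGraph V} (hG : G.IsTree) : ∀ u v, G.Adj u v → Ext G u v →
    ∀ a, os G u v = 2 * a + 1 → ∃ (l : ℕ) (p q : ℕ → V), l + a + 1 = (sd G u v).card ∧ a ≤ l ∧
      p l = u ∧ (∀ i, i < l → G.Adj (p i) (p (i + 1))) ∧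
      (∀ i, 1 ≤ i → i ≤ a → G.Adj (q i) (p i)) ∧
      (∀ x ∈ sd G u v, (∃ i ≤ l, x = p i) ∨ (∃ i, 1 ≤ i ∧ i ≤ a ∧ x = q i)) := by
  apply side_induction hG
  intro u v h ih hE a ha
  obtain ⟨c1, c2⟩ := ext_cases hG h hE
  have hcov : ∀ x ∈ sd G u v, x = u ∨ ∃ w ∈ (G.neighborFinset u).erase v, x ∈ sd G w u := by
    intro x hx
    by_cases hxu : x = u
    · exact Or.inl hxu
    · right
      obtain ⟨w, hw, hd⟩ := exists_closer hG.connected hxu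
      refine ⟨w, ?_, by rw [mem_sd]; omega⟩
      simp only [mem_erase, mem_neighborFinset]
      refine ⟨?_, hw⟩
      rintro rfl
      rw [mem_sd] at hx
      omega
  obtain ⟨e1, e2, -⟩ := step_sides hG h
  generalize hC : (G.neighborFinset u).erase v = C at *
  rcases c2 with rfl | ⟨w, rfl⟩ | ⟨w1, w2, hne, rfl, h1, h2, h3⟩
  · refine ⟨0, fun _ => u, fun _ => u, ?_, ?_, rfl, ?_, ?_, ?_⟩
    · simp at e1 e2; omega
    · simp at e1 e2; omega
    · intro i hi; omega
    · simp at e1 e2; intro i; omega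
    · intro x hx
      left
      rcases hcov x hx with h' | ⟨w, hw, -⟩
      · exact ⟨0, le_rfl, h'⟩
      · simp at hw
  · have hw : w ∈ ({w} : Finset V) := by simp
    simp only [Finset.sum_singleton, Finset.card_singleton, Nat.not_even_one, if_false] at e1 e2
    obtain ⟨l, p, q, l1, l2, l3, l4, l5, l6⟩ := ih w hw (c1 w hw) a (by omega)
    have hwu : G.Adj w u := child_adj (v := v) (by rw [hC]; exact hw)
    refine ⟨l + 1, Function.update p (l + 1) u, q, by omega, by omega, by simp, ?_, ?_, ?_⟩
    · intro i hi
      rw [Function.update_of_ne (by omega)]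
      by_cases hil : i = l
      · subst hil; rw [Function.update_self, l3]; exact hwu
      · rw [Function.update_of_ne (by omega)]; exact l4 i (by omega)
    · intro i h1 h2
      rw [Function.update_of_ne (by omega)]; exact l5 i h1 h2
    · intro x hx
      rcases hcov x hx with h' | ⟨w', hw', hx'⟩
      · exact Or.inl ⟨l + 1, le_rfl, by simp [h']⟩
      · simp only [mem_singleton] at hw'
        subst hw'
        rcases l6 x hx' with ⟨i, hi, hxi⟩ | h''
        · exact Or.inl ⟨i, by omega, by rw [Function.update_of_ne (by omega)]; exact hxi⟩
        · exact Or.inr h''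
  · have hw1 : w1 ∈ ({w1, w2} : Finset V) := by simp
    have hw2 : w2 ∈ ({w1, w2} : Finset V) := by simp
    simp only [Finset.sum_pair hne, Finset.card_pair hne, even_two, if_true] at e1 e2
    have hwu : G.Adj w1 u := child_adj (v := v) (by rw [hC]; exact hw1)
    have hwu2 : G.Adj w2 u := child_adj (v := v) (by rw [hC]; exact hw2)
    obtain ⟨a', ha'⟩ := os_odd hG w1 u hwu
    obtain ⟨l, p, q, l1, l2, l3, l4, l5, l6⟩ := ih w1 hw1 (c1 w1 hw1) a' ha'
    refine ⟨l + 1, Function.update p (l + 1) u, Function.update q a w2, by omega, by omega,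
      by simp, ?_, ?_, ?_⟩
    · intro i hi
      rw [Function.update_of_ne (by omega)]
      by_cases hil : i = l
      · subst hil; rw [Function.update_self, l3]; exact hwu
      · rw [Function.update_of_ne (by omega)]; exact l4 i (by omega)
    · intro i i1 i2
      by_cases hia : i = a
      · have : a = l + 1 := by omega
        subst hia; rw [Function.update_self, this, Function.update_self]; exact hwu2
      · rw [Function.update_of_ne hia, Function.update_of_ne (by omega)]
        exact l5 i i1 (by omega)
    · intro x hx
      rcases hcov x hx with h' | ⟨w', hw', hx'⟩
      · exact Or.inl ⟨l + 1, le_rfl, by simp [h']⟩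
      · simp only [mem_insert, mem_singleton] at hw'
        rcases hw' with rfl | rfl
        · rcases l6 x hx' with ⟨i, hi, hxi⟩ | ⟨i, i1, i2, hxi⟩
          · exact Or.inl ⟨i, by omega, by rw [Function.update_of_ne (by omega)]; exact hxi⟩
          · exact Or.inr ⟨i, i1, by omega, by rw [Function.update_of_ne (by omega)]; exact hxi⟩
        · right
          refine ⟨a, by omega, le_rfl, ?_⟩
          rw [Function.update_self]
          obtain ⟨z, hz⟩ := Finset.card_eq_one.1 h2
          have k1 : w' ∈ sd G w' u := self_mem_sd hwu2
          rw [hz, mem_singleton] at k1 hx'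
          rw [hx', k1]

end MoAux

namespace MoAux

def V4 (h h' a b : ℤ) : ℤ := 2 * h ^ 2 + 2 * h + 2 * h' ^ 2 + 2 * h' - 4 * a ^ 2 - 4 * b ^ 2

lemma num_m2 (s1 s2 a1 a2 h h' a b : ℤ) (hs : s1 + s2 = h + h') (h1 : s1 ≤ h) (h2 : s2 ≤ h)
    (hh : h' ≤ h) (hh' : h ≤ h' + 1) (hab : b ≤ a) (hab' : a ≤ b + 1) (ha : a1 + a2 = a + b)
    (hV : V4 h h' a b ≤ bd s1 (2 * a1 + 1) + bd s2 (2 * a2 + 1)) :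
    V4 h h' a b = bd s1 (2 * a1 + 1) + bd s2 (2 * a2 + 1) ∧
      (a1 = a ∧ a2 = b ∨ a1 = b ∧ a2 = a) := by
  have key : bd s1 (2 * a1 + 1) + bd s2 (2 * a2 + 1) - V4 h h' a b =
      4 * a ^ 2 + 4 * b ^ 2 - 4 * a1 ^ 2 - 4 * a2 ^ 2 := by
    have : s1 = h ∧ s2 = h' ∨ s1 = h' ∧ s2 = h := by omega
    rcases this with ⟨rfl, rfl⟩ | ⟨rfl, rfl⟩ <;> unfold bd V4 <;> ring
  have e1 : a1 = a + b - a2 := by linarith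
  subst e1
  have key2 : (a2 - a) * (a2 - b) ≤ 0 := by nlinarith
  have : a2 = a ∨ a2 = b := by
    by_contra hcon
    push Not at hcon
    obtain ⟨c1, c2⟩ := hcon
    rcases lt_or_gt_of_ne c1 with g1 | g1 <;> rcases lt_or_gt_of_ne c2 with g2 | g2
    · nlinarith
    · omega
    · omega
    · nlinarith
  rcases this with rfl | rfl
  · refine ⟨?_, Or.inr ⟨by ring, rfl⟩⟩
    nlinarith
  · refine ⟨?_, Or.inl ⟨by ring, rfl⟩⟩
    nlinarith

set_option maxHeartbeats 1000000 in
lemma num_m3 (s1 s2 s3 a1 a2 a3 h h' a b : ℤ) (hs : s1 + s2 + s3 = h + h') (h1 : s1 ≤ h)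
    (hh : h' ≤ h) (hh' : h ≤ h' + 1) (hab : b ≤ a) (hab' : a ≤ b + 1)
    (ha : a1 + a2 + a3 + 1 = a + b) (h12 : s2 ≤ s1) (h23 : s3 ≤ s2)
    (p1 : 0 ≤ a1) (p2 : 0 ≤ a2) (p3 : 0 ≤ a3)
    (q1 : 2 * a1 + 1 ≤ s1) (q2 : 2 * a2 + 1 ≤ s2) (q3 : 2 * a3 + 1 ≤ s3)
    (hV : V4 h h' a b ≤ bd s1 (2 * a1 + 1) + bd s2 (2 * a2 + 1) + bd s3 (2 * a3 + 1)) :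
    V4 h h' a b = bd s1 (2 * a1 + 1) + bd s2 (2 * a2 + 1) + bd s3 (2 * a3 + 1) ∧
      s3 = 1 ∧ a3 = 0 ∧ s2 = 2 * a2 + 1 ∧ (a1 = a ∧ a2 + 1 = b ∨ a1 = b ∧ a2 + 1 = a) := by
  by_cases h3 : s3 = 1
  · subst h3
    have : a3 = 0 := by omega
    subst this
    have hE : V4 h h' a b - (bd s1 (2 * a1 + 1) + bd s2 (2 * a2 + 1) + bd 1 (2 * 0 + 1)) =
        4 * (s2 - 2 * a2 - 1) + 2 * ((a2 - a1 + 1) ^ 2 - (a - b) ^ 2) := by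
      have e1 : a1 = a + b - a2 - 1 := by omega
      subst e1
      have : s1 = s2 ∧ h = s2 + 1 ∧ h' = s2 ∨ s1 = s2 + 1 ∧ h = s2 + 1 ∧ h' = s2 + 1 ∨
        s1 = s2 + 2 ∧ h = s2 + 2 ∧ h' = s2 + 1 := by omega
      rcases this with ⟨rfl, rfl, rfl⟩ | ⟨rfl, rfl, rfl⟩ | ⟨rfl, rfl, rfl⟩ <;>
        unfold bd V4 <;> ring
    have hsq : (a - b) ^ 2 ≤ (a2 - a1 + 1) ^ 2 := by
      have : a = b ∨ a = b + 1 := by omega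
      rcases this with rfl | rfl
      · nlinarith [sq_nonneg (a2 - a1 + 1)]
      · have : a2 - a1 + 1 ≤ -1 ∨ 1 ≤ a2 - a1 + 1 := by omega
        rcases this with h | h <;> nlinarith
    have z1 : s2 = 2 * a2 + 1 := by nlinarith
    have z2 : (a2 - a1 + 1) ^ 2 = (a - b) ^ 2 := by nlinarith
    refine ⟨by nlinarith, rfl, rfl, z1, ?_⟩
    rcases sq_eq_sq_iff_eq_or_eq_neg.1 z2 with h | h <;> omega
  · exfalso
    have h3' : 2 ≤ s3 := by omega
    obtain ⟨dl, hdl⟩ : ∃ dl, dl = s2 + s3 - s1 := ⟨_, rfl⟩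
    have hd1 : -1 ≤ dl := by omega
    have hd2 : dl ≤ s3 := by omega
    have hhsq : 0 ≤ (h - h') ^ 2 := sq_nonneg _
    have habsq : (a - b) ^ 2 ≤ 1 := by
      have : a = b ∨ a = b + 1 := by omega
      rcases this with rfl | rfl <;> ring_nf <;> norm_num
    have hE : V4 h h' a b - (bd s1 (2 * a1 + 1) + bd s2 (2 * a2 + 1) + bd s3 (2 * a3 + 1)) =
        4 * s2 * s3 - dl ^ 2 - (8 * a2 * a3 + 8 * (a2 + a3) + 4 - 2 * (a2 + a3 - a1 + 1) ^ 2)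
        + (h - h') ^ 2 - 2 * (a - b) ^ 2 := by
      have e1 : h = s1 + s2 + s3 - h' := by omega
      have e2 : a = a1 + a2 + a3 + 1 - b := by omega
      subst e1 e2 hdl
      unfold bd V4; ring
    have hdsq : dl ^ 2 ≤ s3 ^ 2 := sq_le_sq' (by omega) hd2
    have hss : s3 ^ 2 ≤ s2 * s3 := by
      rw [pow_two]; exact mul_le_mul_of_nonneg_right h23 (by omega)
    have hG : 3 ≤ 4 * s2 * s3 - dl ^ 2 -
        (8 * a2 * a3 + 8 * (a2 + a3) + 4 - 2 * (a2 + a3 - a1 + 1) ^ 2) := by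
      have hsq0 : 0 ≤ (a2 + a3 - a1 + 1) ^ 2 := sq_nonneg _
      by_cases hp : 2 * a2 + 1 < s2
      · have k : (2 * a2 + 2) * (2 * a3 + 2) ≤ s2 * (s3 + 1) := by
          apply mul_le_mul <;> omega
        have k0 : 0 ≤ s2 * (s3 - 2) := mul_nonneg (by omega) (by omega)
        linarith
      · by_cases hq : 2 * a3 + 1 < s3
        · have k : (2 * a2 + 2) * (2 * a3 + 2) ≤ (s2 + 1) * s3 := by
            apply mul_le_mul <;> omega
          have k0 : 0 ≤ (s2 - 2) * s3 := mul_nonneg (by omega) (by omega)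
          linarith
        · have e2 : s2 = 2 * a2 + 1 := by omega
          have e3 : s3 = 2 * a3 + 1 := by omega
          have k1 : (dl + 1) ^ 2 ≤ (2 * (a2 + a3 - a1 + 1)) ^ 2 := by
            apply pow_le_pow_left₀ <;> omega
          have k2 : (dl - 1) ^ 2 ≤ (s3 - 1) ^ 2 := by
            apply sq_le_sq' <;> omega
          have k3 : (s3 - 1) * (s3 - 1) ≤ (s2 - 1) * (s3 - 1) := by
            apply mul_le_mul_of_nonneg_right <;> omega
          have k4 : 4 ≤ (s3 - 1) * (s3 - 1) := by
            have : 2 ≤ s3 - 1 := by omega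
            exact mul_le_mul this this (by norm_num) (by omega)
          have k5 : 8 * a2 * a3 + 8 * (a2 + a3) + 4 = 2 * (s2 + 1) * (s3 + 1) - 4 := by
            rw [e2, e3]; ring
          clear hV hE habsq hhsq hdsq hss
          linarith
    linarith

set_option maxHeartbeats 1000000 in
lemma num_m4 (s1 s2 a1 a2 S Sq y h h' a b : ℤ) (hs : s1 + s2 + S = h + h') (h1 : s1 ≤ h)
    (hh : h' ≤ h) (hh' : h ≤ h' + 1) (hab : b ≤ a) (hab' : a ≤ b + 1)
    (ha : a1 + a2 + y = a + b) (h12 : s2 ≤ s1) (h2 : 1 ≤ s2)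
    (p1 : 0 ≤ a1) (p2 : 0 ≤ a2) (p3 : 0 ≤ y) (q1 : 2 * a1 + 1 ≤ s1) (q2 : 2 * a2 + 1 ≤ s2)
    (hSq : Sq ≤ s2 * S) (hS : 2 ≤ S)
    (hcase : 2 * y ≤ S ∨ (2 * y ≤ S + 1 ∧ 3 ≤ S ∧ Sq ≤ (S - 2) * S)) :
    bd s1 (2 * a1 + 1) + bd s2 (2 * a2 + 1) + (2 * Sq + 2 * S) < V4 h h' a b := by
  have hhsq : 0 ≤ (h - h') ^ 2 := sq_nonneg _
  have habsq : (a - b) ^ 2 ≤ 1 := by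
    have : a = b ∨ a = b + 1 := by omega
    rcases this with rfl | rfl <;> ring_nf <;> norm_num
  obtain ⟨e, he⟩ : ∃ e, e = s1 - s2 := ⟨_, rfl⟩
  have he0 : 0 ≤ e := by omega
  have he1 : e ≤ S + 1 := by omega
  have hs1 : s1 = s2 + e := by omega
  have hE : V4 h h' a b - (bd s1 (2 * a1 + 1) + bd s2 (2 * a2 + 1) + (2 * Sq + 2 * S)) =
      (2 * (2 * s2 + e) * S + S ^ 2 - e ^ 2 - 2 * Sq) -
      (-2 * (a1 - a2) ^ 2 + 2 * (a1 + a2) * (2 * y) + 2 * y ^ 2) + (h - h') ^ 2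
        - 2 * (a - b) ^ 2 := by
    have e1 : h = s1 + s2 + S - h' := by omega
    have e2 : a = a1 + a2 + y - b := by omega
    subst e1 e2 hs1
    unfold bd V4; ring
  have hA : 2 * (a1 + a2) ≤ 2 * s2 + e - 2 := by omega
  rcases hcase with hy | ⟨hy, hS3, hSq2⟩
  · have k1 : 2 * (a1 + a2) * (2 * y) ≤ (2 * s2 + e - 2) * S := by
      apply mul_le_mul <;> omega
    have k2 : (2 * y) ^ 2 ≤ S ^ 2 := by apply pow_le_pow_left₀ <;> omega
    have k3 : 0 ≤ (a1 - a2) ^ 2 := sq_nonneg _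
    have k4 : -(S + 1) ≤ e * (S - e) := by
      rcases le_or_gt e S with h | h
      · have := mul_nonneg he0 (sub_nonneg.2 h)
        linarith
      · have : e = S + 1 := by omega
        subst this
        linarith
    have k5 : 2 * 2 ≤ S * S := mul_le_mul hS hS (by norm_num) (by omega)
    linarith
  · have k1 : 2 * (a1 + a2) * (2 * y) ≤ 2 * (a1 + a2) * (S + 1) := by
      apply mul_le_mul_of_nonneg_left <;> omega
    have k2 : (2 * y) ^ 2 ≤ (S + 1) ^ 2 := by apply pow_le_pow_left₀ <;> omega
    -- key estimate
    have k3 : 4 * (a1 + a2) * (S + 1) - 4 * (a1 - a2) ^ 2 ≤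
        2 * (2 * s2 - 2 + e) * (S + 1) - e ^ 2 := by
      obtain ⟨q, hq⟩ : ∃ q, q = s2 - 1 - 2 * a2 := ⟨_, rfl⟩
      obtain ⟨r, hr⟩ : ∃ r, r = s1 - 1 - 2 * a1 := ⟨_, rfl⟩
      have hq0 : 0 ≤ q := by omega
      have hr0 : 0 ≤ r := by omega
      have e1 : 2 * (a1 - a2) = e + q - r := by omega
      have e2 : 2 * (a1 + a2) = 2 * s2 - 2 + e - q - r := by omega
      have e3 : 4 * (a1 - a2) ^ 2 = (e + q - r) ^ 2 := by rw [← e1]; ring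
      have e4 : 4 * (a1 + a2) * (S + 1) = 2 * (2 * s2 - 2 + e - q - r) * (S + 1) := by
        rw [← e2]; ring
      rw [e3, e4]
      have m1 : 0 ≤ q * (S + 1) := by positivity
      have m2 : 0 ≤ r * (S + 1 - e) := mul_nonneg hr0 (by omega)
      have m3 : 0 ≤ q * e := by positivity
      nlinarith [sq_nonneg (q - r)]
    have k4 : 0 ≤ e * (2 * S - 2 - e) := by
      apply mul_nonneg he0
      omega
    by_cases hc : s2 ≤ S - 3
    · linarith [sq_nonneg (S - 1)]
    · have k5 : 0 ≤ (s2 - (S - 2)) * (S - 1) := mul_nonneg (by omega) (by omega)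
      linarith [sq_nonneg (S - 1)]

end MoAux

namespace MoAux
set_option linter.unusedSectionVars false
variable {V : Type*} [Fintype V]

/-- the conclusion of the centroid analysis -/
def Good (G : SimpleGraph V) (a b : ℕ) : Prop :=
  ∃ u v, G.Adj u v ∧ Ext G u v ∧ Ext G v u ∧ os G u v = 2 * a + 1 ∧ os G v u = 2 * b + 1

lemma good_of {G : SimpleGraph V} {u v : V} {a b : ℕ} {x y : ℤ} (h : G.Adj u v)
    (h1 : Ext G u v) (h2 : Ext G v u) (hx : (os G u v : ℤ) = 2 * x + 1)
    (hy : (os G v u : ℤ) = 2 * y + 1) (hc : x = a ∧ y = b ∨ x = b ∧ y = a) : Good G a b := by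
  rcases hc with ⟨rfl, rfl⟩ | ⟨rfl, rfl⟩
  · exact ⟨u, v, h, h1, h2, by omega, by omega⟩
  · exact ⟨v, u, h.symm, h2, h1, by omega, by omega⟩

lemma sum_bd_le {ι : Type*} (J : Finset ι) (s o : ι → ℤ) :
    ∑ i ∈ J, bd (s i) (o i) ≤ 2 * ∑ i ∈ J, s i ^ 2 + 2 * ∑ i ∈ J, s i := by
  rw [Finset.mul_sum, Finset.mul_sum, ← Finset.sum_add_distrib]
  apply Finset.sum_le_sum
  intro i _
  unfold bd
  linarith [sq_nonneg (o i - 1)]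

lemma sum_sq_le {ι : Type*} (J : Finset ι) (s : ι → ℤ) (M : ℤ) (h1 : ∀ i ∈ J, 0 ≤ s i)
    (h : ∀ i ∈ J, s i ≤ M) : ∑ i ∈ J, s i ^ 2 ≤ M * ∑ i ∈ J, s i := by
  rw [Finset.mul_sum]
  apply Finset.sum_le_sum
  intro i hi
  rw [pow_two]
  exact mul_le_mul_of_nonneg_right (h i hi) (h1 i hi)

lemma card_le_sum {ι : Type*} (J : Finset ι) (s : ι → ℤ) (h1 : ∀ i ∈ J, 1 ≤ s i) :
    (J.card : ℤ) ≤ ∑ i ∈ J, s i := by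
  have := Finset.sum_le_sum h1
  simpa using this

set_option maxHeartbeats 8000000 in
theorem good_edge {G : SimpleGraph V} (hG : G.IsTree) (n k : ℕ) (hn : Fintype.card V = n)
    (hk : 1 ≤ k) (hn2 : 2 ≤ n) (hodd : oddDegreeCount G = 2 * k) (c : V)
    (hc : ∀ w, G.Adj w c → 2 * (sd G w c).card ≤ Fintype.card V)
    (hV : V4 (n / 2 : ℕ) ((n - 1 - n / 2 : ℕ)) (k / 2 : ℕ) ((k - 1) / 2 : ℕ) ≤ 4 * Ds G c) :
    Good G (k / 2) ((k - 1) / 2) := by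
  obtain ⟨N, hN⟩ : ∃ N, N = G.neighborFinset c := ⟨_, rfl⟩
  have hcard := card_root hG c
  have hroot := odd_root hG c
  have hD := Ds_eq hG c
  have hdeg : G.degree c = N.card := by rw [hN]; rfl
  rw [hodd, hdeg] at hroot
  rw [hn] at hcard hc
  have hD' : (4 * Ds G c : ℤ) = ∑ w ∈ N, 4 * (Fs G w c : ℤ) := by
    rw [hD, ← hN]; push_cast; rw [Finset.mul_sum]
  rw [hD'] at hV
  rw [← hN] at hcard hroot
  have adj : ∀ w ∈ N, G.Adj w c := by
    intro w hw
    rw [hN, mem_neighborFinset] at hw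
    exact hw.symm
  have hmemN : ∀ w ∈ N, c ∈ G.neighborFinset w := fun w hw => by
    simpa using adj w hw
  have hFs : ∀ w ∈ N, (4 * Fs G w c : ℤ) ≤ bd (sd G w c).card (os G w c) :=
    fun w hw => Fs_le hG w c (adj w hw)
  obtain ⟨s, hs⟩ : ∃ s : V → ℤ, ∀ w, s w = (sd G w c).card := ⟨_, fun _ => rfl⟩
  obtain ⟨o, ho⟩ : ∃ o : V → ℤ, ∀ w, o w = os G w c := ⟨_, fun _ => rfl⟩
  have ho1 : ∀ w ∈ N, 1 ≤ o w := fun w hw => by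
    rw [ho]; exact_mod_cast os_pos hG (adj w hw)
  have hos : ∀ w, o w ≤ s w := fun w => by rw [ho, hs]; exact_mod_cast os_le G w c
  have hs1 : ∀ w ∈ N, 1 ≤ s w := fun w hw => (ho1 w hw).trans (hos w)
  have hodd' : ∀ w ∈ N, ∃ r : ℤ, 0 ≤ r ∧ o w = 2 * r + 1 := fun w hw => by
    obtain ⟨r, hr⟩ := os_odd hG w c (adj w hw)
    exact ⟨r, by omega, by rw [ho, hr]; push_cast; ring⟩
  have hcard' : (n : ℤ) = 1 + ∑ w ∈ N, s w := by
    rw [hcard]; push_cast; simp only [hs]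
  have hroot' : (2 * k : ℤ) = (if Odd N.card then 1 else 0) + ∑ w ∈ N, o w := by
    have : ((2 * k : ℕ) : ℤ) = _ := congrArg _ hroot
    push_cast at this
    rw [this]; simp only [ho]
  have hFs' : ∀ w ∈ N, (4 * Fs G w c : ℤ) ≤ bd (s w) (o w) := fun w hw => by
    rw [hs, ho]; exact hFs w hw
  have hExt : ∀ w, (4 * Fs G w c : ℤ) = bd (s w) (o w) → Ext G w c := fun w hw => by
    unfold Ext; rw [← hs, ← ho]; exact hw
  have hcs : ∀ w ∈ N, 2 * s w ≤ n := fun w hw => by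
    rw [hs]; exact_mod_cast hc w (adj w hw)
  obtain ⟨h, hh⟩ : ∃ h : ℤ, h = (n / 2 : ℕ) := ⟨_, rfl⟩
  obtain ⟨h', hh'⟩ : ∃ h' : ℤ, h' = (n - 1 - n / 2 : ℕ) := ⟨_, rfl⟩
  obtain ⟨a, hA⟩ : ∃ a : ℤ, a = (k / 2 : ℕ) := ⟨_, rfl⟩
  obtain ⟨b, hB⟩ : ∃ b : ℤ, b = ((k - 1) / 2 : ℕ) := ⟨_, rfl⟩
  rw [← hh, ← hh', ← hA, ← hB] at hV
  have hne : N.Nonempty := by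
    rw [Finset.nonempty_iff_ne_empty]
    rintro rfl
    simp at hcard'; omega
  obtain ⟨w1, hw1, hmax1⟩ := Finset.exists_max_image N s hne
  have hstep := step_sides hG (adj w1 hw1).symm
  rw [← hN] at hstep
  simp only [← hs, ← ho] at hstep
  obtain ⟨e1, e2, e3⟩ := hstep
  have hcN : N.card = (N.erase w1).card + 1 := (Finset.card_erase_add_one hw1).symm
  rw [← Finset.add_sum_erase _ _ hw1] at hcard' hroot' hV
  have b1 := hcs w1 hw1
  have f1 := hFs' w1 hw1
  obtain ⟨a1, ha1, ha1'⟩ := hodd' w1 hw1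
  have q1 := hos w1
  rcases (N.erase w1).eq_empty_or_nonempty with hN1 | hN1
  · rw [hN1] at hcard' hroot' hV e1 e2 e3 hcN
    simp at hcard' hroot' hV e1 e2 e3 hcN
    rw [hcN] at hroot'
    simp at hroot'
    have z1 : s w1 = 1 := by omega
    have z2 : o w1 = 1 := by omega
    have g : (4 * Fs G w1 c : ℤ) = bd (s w1) (o w1) := by
      apply le_antisymm f1
      have := (step_sides hG (adj w1 hw1)).2.2
      rw [this, ← hs, z1, z2]
      have : 0 ≤ ∑ w ∈ (G.neighborFinset w1).erase c, 4 * (Fs G w w1 : ℤ) :=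
        Finset.sum_nonneg (fun w _ => by omega)
      simp [bd]; linarith
    have g2 : Ext G c w1 := by
      unfold Ext; rw [e3, e1, e2]; simp [bd]
    refine good_of (x := 0) (y := 0) (adj w1 hw1) (hExt _ g) g2 ?_ ?_ ?_
    · rw [← ho, z2]; norm_num
    · rw [e2]; norm_num
    · left; constructor <;> omega
  obtain ⟨w2, hw2, hmax2⟩ := Finset.exists_max_image (N.erase w1) s hN1
  have hw2N := Finset.mem_of_mem_erase hw2
  have hcN1 : (N.erase w1).card = ((N.erase w1).erase w2).card + 1 :=
    (Finset.card_erase_add_one hw2).symm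
  rw [← Finset.add_sum_erase _ _ hw2] at hcard' hroot' hV e1 e2 e3
  have b2 := hcs w2 hw2N
  have f2 := hFs' w2 hw2N
  obtain ⟨a2, ha2, ha2'⟩ := hodd' w2 hw2N
  have q2 := hos w2
  have hJN : ∀ w ∈ (N.erase w1).erase w2, w ∈ N := fun w hw =>
    Finset.mem_of_mem_erase (Finset.mem_of_mem_erase hw)
  have hJ2 : ∀ w ∈ (N.erase w1).erase w2, s w ≤ s w2 := fun w hw =>
    hmax2 w (Finset.mem_of_mem_erase hw)
  have h12 := hmax1 w2 hw2N
  generalize (N.erase w1).erase w2 = J at *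
  have hcc : J.card = 0 ∨ J.card = 1 ∨ 2 ≤ J.card := by omega
  rcases hcc with hJ | hJ | hJ
  · rw [Finset.card_eq_zero] at hJ
    subst hJ
    simp at hcN1
    rw [hcN1] at hcN e2
    rw [hcN] at hroot'
    simp at hroot' hcard' hV e1 e2 e3
    have := num_m2 (s w1) (s w2) a1 a2 h h' a b (by omega) (by omega) (by omega) (by omega)
      (by omega) (by omega) (by omega) (by omega) (by rw [← ha1', ← ha2']; linarith)
    obtain ⟨r1, r2⟩ := this
    rw [← ha1', ← ha2'] at r1
    have g1 : (4 * Fs G w1 c : ℤ) = bd (s w1) (o w1) := by linarith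
    have g2 : (4 * Fs G w2 c : ℤ) = bd (s w2) (o w2) := by linarith
    refine good_of (x := a1) (y := a2) (adj w1 hw1) (hExt _ g1) ?_ ?_ ?_ ?_
    · unfold Ext; rw [e3, e1, e2, g2]; unfold bd; ring
    · rw [← ho, ha1']
    · rw [e2, ha2']
    · rw [hA, hB] at r2; exact r2
  · obtain ⟨w3, rfl⟩ := Finset.card_eq_one.1 hJ
    rw [hJ] at hcN1
    rw [hcN1] at hcN e2
    rw [hcN] at hroot'
    have hw3N := hJN w3 (by simp)
    obtain ⟨a3, ha3, ha3'⟩ := hodd' w3 hw3N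
    have q3 := hos w3
    have f3 := hFs' w3 hw3N
    have h23 := hJ2 w3 (by simp)
    have d1 : Odd (1 + 1 + 1) := by decide
    have d2 : Even (1 + 1) := by decide
    rw [if_pos d1] at hroot'
    rw [if_pos d2] at e2
    simp only [Finset.sum_singleton] at hroot' hcard' hV e1 e2 e3
    have := num_m3 (s w1) (s w2) (s w3) a1 a2 a3 h h' a b (by omega) (by omega) (by omega)
      (by omega) (by omega) (by omega) (by omega) (by omega) (by omega) ha1 ha2 ha3 (by omega)
      (by omega) (by omega) (by rw [← ha1', ← ha2', ← ha3']; linarith)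
    obtain ⟨r1, r2, r3, r4, r5⟩ := this
    rw [← ha1', ← ha2', ← ha3'] at r1
    have g1 : (4 * Fs G w1 c : ℤ) = bd (s w1) (o w1) := by linarith
    have g2 : (4 * Fs G w2 c : ℤ) = bd (s w2) (o w2) := by linarith
    have g3 : (4 * Fs G w3 c : ℤ) = bd (s w3) (o w3) := by linarith
    refine good_of (x := a1) (y := a2 + 1) (adj w1 hw1) (hExt _ g1) ?_ ?_ ?_ ?_
    · unfold Ext; rw [e3, e1, e2, g2, g3, r2, ha3', r3, ha2', r4]; unfold bd; ring
    · rw [← ho, ha1']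
    · rw [e2, ha2', ha3', r3]; ring
    · rw [hA, hB] at r5; exact r5
  · exfalso
    have hJs : ∀ w ∈ J, 1 ≤ s w := fun w hw => hs1 w (hJN w hw)
    have t1 := sum_bd_le J s o
    have t2 := sum_sq_le J s (s w2) (fun w hw => by linarith [hJs w hw]) hJ2
    have t3 := card_le_sum J s hJs
    have t4 : ∑ w ∈ J, o w ≤ ∑ w ∈ J, s w := Finset.sum_le_sum (fun w _ => hos w)
    have t5 : ∑ w ∈ J, 4 * (Fs G w c : ℤ) ≤ ∑ w ∈ J, bd (s w) (o w) :=
      Finset.sum_le_sum (fun w hw => hFs' w (hJN w hw))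
    have t6 := card_le_sum J o (fun w hw => ho1 w (hJN w hw))
    have hJc : (2:ℤ) ≤ J.card := by exact_mod_cast hJ
    have hS2 : 3 ≤ J.card → ∑ w ∈ J, s w ^ 2 ≤ (∑ w ∈ J, s w - 2) * ∑ w ∈ J, s w := by
      intro hJ3
      apply sum_sq_le J s _ (fun w hw => by linarith [hJs w hw])
      intro w hw
      have := card_le_sum (J.erase w) s (fun w hw => hJs w (Finset.mem_of_mem_erase hw))
      rw [Finset.card_erase_of_mem hw] at this
      have e := Finset.add_sum_erase J s hw
      omega
    have := num_m4 (s w1) (s w2) a1 a2 (∑ w ∈ J, s w) (∑ w ∈ J, s w ^ 2) (k - 1 - a1 - a2)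
      h h' a b (by omega) (by omega) (by omega) (by omega) (by omega) (by omega) (by omega)
      (by omega) (by omega) ha1 ha2 (by split_ifs at hroot' <;> omega) (by omega) (by omega) t2
      (by omega) (by
        by_cases hO : Odd N.card
        · right
          have hJ3 : 3 ≤ J.card := by
            obtain ⟨r, hr⟩ := hO
            omega
          rw [if_pos hO] at hroot'
          exact ⟨by omega, by omega, hS2 hJ3⟩
        · left
          rw [if_neg hO] at hroot'
          omega)
    rw [← ha1', ← ha2'] at this
    linarith

end MoAux

namespace MoAux
set_option linter.unusedSectionVars false

/-- parent function of the caterpillar, with m the length of its spine -/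
def par (m a b v : ℕ) : ℕ :=
  if v < m then v - 1 else if v < m + a then v - m + 1 else v - a - b - 1

def IsCat {n : ℕ} (m a b : ℕ) (G : SimpleGraph (Fin n)) : Prop :=
  ∀ u v : Fin n, G.Adj u v ↔ (1 ≤ u.val ∧ par m a b u = v) ∨ (1 ≤ v.val ∧ par m a b v = u)

lemma catC_isCat {n m a b : ℕ} (hn : n = m + a + b) (hm : a + b + 2 ≤ m) :
    IsCat m a b (catC n a b) := by
  intro u v
  have e1 : n - a - b = m := by omega
  have e2 : n - b = m + a := by omega
  unfold catC parentGraph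
  rw [SimpleGraph.fromRel_adj]
  simp only [e1, e2, ne_eq, Fin.ext_iff, par]
  obtain ⟨u, hu⟩ := u
  obtain ⟨v, hv⟩ := v
  simp only
  split_ifs <;> omega

lemma cat_connected {n m a b : ℕ} (hn : n = m + a + b) (hm : a + b + 2 ≤ m)
    {G : SimpleGraph (Fin n)} (hG : IsCat m a b G) : G.Connected := by
  have h0 : 0 < n := by omega
  have key : ∀ N : ℕ, ∀ h : N < n, G.Reachable ⟨N, h⟩ ⟨0, h0⟩ := by
    intro N
    induction N using Nat.strong_induction_on with
    | _ N ih =>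
      intro h
      rcases Nat.eq_zero_or_pos N with rfl | hN
      · exact Reachable.refl _
      · have hlt : par m a b N < N := by unfold par; split_ifs <;> omega
        have hadj : G.Adj ⟨N, h⟩ ⟨par m a b N, hlt.trans h⟩ := (hG _ _).2 (Or.inl ⟨hN, rfl⟩)
        exact hadj.reachable.trans (ih _ hlt _)
  have : Nonempty (Fin n) := ⟨⟨0, h0⟩⟩
  exact Connected.mk (fun u v => (key u u.2).trans (key v v.2).symm)

lemma cat_isTree {n m a b : ℕ} (hn : n = m + a + b) (hm : a + b + 2 ≤ m)
    {G : SimpleGraph (Fin n)} (hG : IsCat m a b G) : G.IsTree := by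
  have hc := cat_connected hn hm hG
  rw [isTree_iff_connected_and_card]
  refine ⟨hc, ?_⟩
  have h0 : 0 < n := by omega
  apply le_antisymm _ hc.card_vert_le_card_edgeSet_add_one
  have hle : ∀ v : Fin n, par m a b v < n := by
    intro v
    have := v.2
    unfold par; split_ifs <;> omega
  have hsub : G.edgeFinset ⊆ (Finset.univ.erase (⟨0, h0⟩ : Fin n)).image
      (fun v => s(v, (⟨par m a b v, hle v⟩ : Fin n))) := by
    intro e he
    induction e using Sym2.ind with
    | _ u v =>
      rw [mem_edgeFinset, mem_edgeSet, hG] at he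
      simp only [mem_image, mem_erase, mem_univ, and_true, Sym2.eq_iff, ne_eq, Fin.ext_iff]
      rcases he with ⟨h1, h2⟩ | ⟨h1, h2⟩
      · exact ⟨u, by omega, Or.inl ⟨rfl, h2⟩⟩
      · exact ⟨v, by omega, Or.inr ⟨rfl, h2⟩⟩
  have h1 := (Finset.card_le_card hsub).trans Finset.card_image_le
  rw [Finset.card_erase_of_mem (mem_univ _), Finset.card_univ, Fintype.card_fin] at h1
  rw [Nat.card_eq_fintype_card, Nat.card_eq_fintype_card, Fintype.card_fin,
    ← edgeFinset_card]
  omega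

lemma deg_of_list {n : ℕ} {G : SimpleGraph (Fin n)} (x : Fin n) (S : Finset (Fin n))
    (h : ∀ y, G.Adj x y ↔ y ∈ S) : G.degree x = S.card := by
  rw [← card_neighborFinset_eq_degree]
  congr 1
  ext y
  rw [mem_neighborFinset, h]

lemma deg_one {n : ℕ} {G : SimpleGraph (Fin n)} (x : Fin n) (p : ℕ) (hp : p < n)
    (h : ∀ y : Fin n, G.Adj x y ↔ y.val = p) : G.degree x = 1 := by
  rw [deg_of_list x {⟨p, hp⟩}]
  · simp
  · intro y; rw [h]; simp [Fin.ext_iff]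

lemma deg_two {n : ℕ} {G : SimpleGraph (Fin n)} (x : Fin n) (p q : ℕ) (hp : p < n) (hq : q < n)
    (hpq : p ≠ q) (h : ∀ y : Fin n, G.Adj x y ↔ y.val = p ∨ y.val = q) : G.degree x = 2 := by
  rw [deg_of_list x {⟨p, hp⟩, ⟨q, hq⟩}]
  · rw [Finset.card_pair]; simp [Fin.ext_iff, hpq]
  · intro y; rw [h]; simp [Fin.ext_iff]

lemma deg_three {n : ℕ} {G : SimpleGraph (Fin n)} (x : Fin n) (p q r : ℕ) (hp : p < n)
    (hq : q < n) (hr : r < n) (hpq : p ≠ q) (hpr : p ≠ r) (hqr : q ≠ r)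
    (h : ∀ y : Fin n, G.Adj x y ↔ y.val = p ∨ y.val = q ∨ y.val = r) : G.degree x = 3 := by
  rw [deg_of_list x {⟨p, hp⟩, ⟨q, hq⟩, ⟨r, hr⟩}]
  · rw [Finset.card_eq_three]
    refine ⟨_, _, _, ?_, ?_, ?_, rfl⟩ <;> simp [Fin.ext_iff, hpq, hpr, hqr]
  · intro y; rw [h]; simp [Fin.ext_iff]

lemma cat_degree {n m a b : ℕ} (hn : n = m + a + b) (hm : a + b + 2 ≤ m)
    {G : SimpleGraph (Fin n)} (hG : IsCat m a b G) (x : Fin n) :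
    ¬ Odd (G.degree x) ↔ a + 1 ≤ x.val ∧ x.val < m - b - 1 := by
  have hx := x.2
  have o1 : Odd 1 := by decide
  have o2 : ¬ Odd 2 := by decide
  have o3 : Odd 3 := by decide
  rcases Nat.lt_or_ge x.val m with h | h
  · by_cases h0 : x.val = 0
    · rw [deg_one x 1 (by omega)]
      · simp only [o1, not_true_eq_false, false_iff]; omega
      · intro y
        have := y.2
        rw [hG]; unfold par; split_ifs <;> omega
    by_cases h1 : x.val = m - 1
    · rw [deg_one x (m - 2) (by omega)]
      · simp only [o1, not_true_eq_false, false_iff]; omega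
      · intro y
        have := y.2
        rw [hG]; unfold par; split_ifs <;> omega
    by_cases h2 : x.val ≤ a
    · rw [deg_three x (x.val - 1) (x.val + 1) (m + x.val - 1) (by omega) (by omega) (by omega)
        (by omega) (by omega) (by omega)]
      · simp only [o3, not_true_eq_false, false_iff]; omega
      · intro y
        have := y.2
        rw [hG]; unfold par; split_ifs <;> omega
    by_cases h3 : m - b - 1 ≤ x.val
    · rw [deg_three x (x.val - 1) (x.val + 1) (x.val + a + b + 1) (by omega) (by omega) (by omega)
        (by omega) (by omega) (by omega)]
      · simp only [o3, not_true_eq_false, false_iff]; omega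
      · intro y
        have := y.2
        rw [hG]; unfold par; split_ifs <;> omega
    · rw [deg_two x (x.val - 1) (x.val + 1) (by omega) (by omega) (by omega)]
      · simp only [o2, not_false_eq_true, true_iff]; omega
      · intro y
        have := y.2
        rw [hG]; unfold par; split_ifs <;> omega
  · rw [deg_one x (par m a b x) (by unfold par; split_ifs <;> omega)]
    · simp only [o1, not_true_eq_false, false_iff]; omega
    · intro y
      have := y.2
      rw [hG]; unfold par; split_ifs <;> omega

lemma cat_odd {n m a b : ℕ} (hn : n = m + a + b) (hm : a + b + 2 ≤ m)
    {G : SimpleGraph (Fin n)} (hG : IsCat m a b G) : oddDegreeCount G = 2 * (a + b + 1) := by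
  unfold oddDegreeCount
  have h1 := Finset.card_filter_add_card_filter_not (s := (Finset.univ : Finset (Fin n)))
    (fun v => Odd (G.degree v))
  have h2 : (Finset.univ.filter fun v : Fin n => ¬ Odd (G.degree v)) =
      Finset.Ico ⟨a + 1, by omega⟩ ⟨m - b - 1, by omega⟩ := by
    ext x
    rw [mem_filter, cat_degree hn hm hG, Finset.mem_Ico, Fin.le_def, Fin.lt_def]
    simp
  have h3 : (Finset.univ.filter fun v : Fin n => ¬ Odd (G.degree v)).card = m - b - 1 - (a + 1) := by
    rw [h2, Fin.card_Ico]
  rw [Finset.card_univ, Fintype.card_fin] at h1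
  omega

lemma sum_up (A : ℤ) (t : ℕ) : 2 * ∑ i ∈ range t, (A + i) = t * (2 * A + t - 1) := by
  induction t with
  | zero => simp
  | succ t ih => rw [Finset.sum_range_succ, mul_add, ih]; push_cast; ring

lemma sum_down (A : ℤ) (t : ℕ) : 2 * ∑ i ∈ range t, (A - i) = t * (2 * A - t + 1) := by
  induction t with
  | zero => simp
  | succ t ih => rw [Finset.sum_range_succ, mul_add, ih]; push_cast; ring

/-- lower bound for the distance to the spine vertex c -/
def hf (m a b c x : ℕ) : ℤ :=
  if x < c then (c : ℤ) - x else if x < m then (x : ℤ) - c else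
    if x < m + a then (c : ℤ) - (x - m) else (x : ℤ) - (a + b) - c

lemma sum_hf (m a b c : ℕ) (hc1 : a ≤ c) (hc2 : c + b + 1 ≤ m) (hm : a + b + 2 ≤ m) :
    2 * ∑ x ∈ range (m + a + b), hf m a b c x =
      (c + a : ℤ) ^ 2 + (c + a) - 2 * a ^ 2 + (m - 1 - c + b : ℤ) ^ 2 + (m - 1 - c + b)
        - 2 * b ^ 2 := by
  obtain ⟨d, rfl⟩ : ∃ d, m = c + (d + 1) := ⟨m - 1 - c, by omega⟩
  rw [Finset.sum_range_add, Finset.sum_range_add, Finset.sum_range_add]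
  have s1 : ∑ x ∈ range c, hf (c + (d + 1)) a b c x = ∑ x ∈ range c, ((c:ℤ) - x) := by
    apply Finset.sum_congr rfl
    intro x hx
    rw [mem_range] at hx
    unfold hf; split_ifs <;> omega
  have s2 : ∑ x ∈ range (d + 1), hf (c + (d + 1)) a b c (c + x) =
      ∑ x ∈ range (d + 1), ((0:ℤ) + x) := by
    apply Finset.sum_congr rfl
    intro x hx
    rw [mem_range] at hx
    unfold hf; split_ifs <;> omega
  have s3 : ∑ x ∈ range a, hf (c + (d + 1)) a b c (c + (d + 1) + x) =
      ∑ x ∈ range a, ((c:ℤ) - x) := by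
    apply Finset.sum_congr rfl
    intro x hx
    rw [mem_range] at hx
    unfold hf; split_ifs <;> omega
  have s4 : ∑ x ∈ range b, hf (c + (d + 1)) a b c (c + (d + 1) + a + x) =
      ∑ x ∈ range b, ((d + 1 - b : ℤ) + x) := by
    apply Finset.sum_congr rfl
    intro x hx
    rw [mem_range] at hx
    unfold hf; split_ifs <;> omega
  rw [s1, s2, s3, s4, mul_add, mul_add, mul_add, sum_down, sum_up, sum_down, sum_up]
  push_cast
  ring

lemma cat_Ds {n m a b : ℕ} (hn : n = m + a + b) (hm : a + b + 2 ≤ m)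
    {G : SimpleGraph (Fin n)} (hG : IsCat m a b G) (c : Fin n) (hc1 : a ≤ c.val)
    (hc2 : c.val + b + 1 ≤ m) :
    V4 (c.val + a : ℕ) (n - 1 - (c.val + a) : ℕ) a b ≤ 4 * Ds G c := by
  have hcon := cat_connected hn hm hG
  have hl := lipschitz_dist hcon (fun x : Fin n => hf m a b c x) (by
    intro x y hxy
    have := x.2
    have := y.2
    rw [hG] at hxy
    unfold hf
    unfold par at hxy
    split_ifs at hxy ⊢ <;> omega)
  have h0 : hf m a b c c = 0 := by unfold hf; split_ifs <;> omega
  have h1 : ∑ x ∈ range (m + a + b), hf m a b c x ≤ Ds G c := by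
    rw [← hn, ← Fin.sum_univ_eq_sum_range]
    unfold Ds
    push_cast
    apply Finset.sum_le_sum
    intro x _
    have := hl x c
    simp only [h0, sub_zero] at this
    exact this
  have h2 := sum_hf m a b c hc1 hc2 hm
  have e : ((n - 1 - (c.val + a) : ℕ) : ℤ) = m - 1 - c.val + b := by omega
  unfold V4
  rw [e]
  push_cast
  linarith

lemma card_fin_le {n : ℕ} (S : Finset (Fin n)) (f : ℕ → ℕ) (t : ℕ) (h1 : ∀ x ∈ S, f x.val < t)
    (h2 : ∀ x ∈ S, ∀ y ∈ S, f x.val = f y.val → x.val = y.val) : S.card ≤ t := by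
  have := Finset.card_le_card_of_injOn (s := S) (t := range t) (fun x => f x.val)
    (fun x hx => by simpa using h1 x hx)
    (fun x hx y hy hxy => Fin.ext (h2 x hx y hy hxy))
  simpa using this

/-- spine position -/
def pos (m a b x : ℕ) : ℕ := if x < m then x else par m a b x

lemma cat_centroid {n m a b : ℕ} (hn : n = m + a + b) (hm : a + b + 2 ≤ m)
    {G : SimpleGraph (Fin n)} (hG : IsCat m a b G) (c : Fin n) (hc1 : a ≤ c.val)
    (hc2 : c.val + b + 1 ≤ m) (hc3 : c.val + a = n / 2) (w : Fin n) (hw : G.Adj w c) :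
    2 * (sd G w c).card ≤ n := by
  have hcon := cat_connected hn hm hG
  have hw' := (hG _ _).1 hw
  have := w.2
  have main : ∀ S : Fin n → Prop, ¬ S w →
      (∀ x y, S x → ¬ S y → G.Adj x y → x = c ∧ y = w) → ∀ x ∈ sd G w c, ¬ S x := by
    intro S h1 h2 x hx hS
    have := cut_dist hcon S h1 hw.symm h2 x hS
    rw [mem_sd] at hx
    omega
  rcases Nat.lt_or_ge w.val m with hwm | hwm
  · rcases Nat.lt_or_ge w.val c.val with hwc | hwc
    · have key := main (fun x => c.val ≤ pos m a b x) (by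
        unfold pos; split_ifs <;> omega) (by
        intro x y hx hy hxy
        have := x.2
        have := y.2
        rw [hG] at hxy
        rw [Fin.ext_iff, Fin.ext_iff]
        unfold pos at hx hy
        unfold par at hx hy hxy hw'
        split_ifs at * <;> omega)
      have : (sd G w c).card ≤ c.val + a := by
        apply card_fin_le _ (fun x => if x < m then x else c.val + (x - m))
        · intro x hx
          have := key x hx
          have := x.2
          unfold pos par at *
          split_ifs at * <;> omega
        · intro x hx y hy
          have := key x hx
          have := key y hy
          have := x.2
          have := y.2
          unfold pos par at *
          split_ifs at * <;> omega
      omega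
    · have key := main (fun x => pos m a b x ≤ c.val) (by
        unfold pos; unfold par at *; split_ifs at * <;> omega) (by
        intro x y hx hy hxy
        have := x.2
        have := y.2
        rw [hG] at hxy
        rw [Fin.ext_iff, Fin.ext_iff]
        unfold pos at hx hy
        unfold par at hx hy hxy hw'
        split_ifs at * <;> omega)
      have : (sd G w c).card ≤ n - 1 - n / 2 := by
        apply card_fin_le _ (fun x => if x < m then x - (c.val + 1) else x - (c.val + 1) - a)
        · intro x hx
          have := key x hx
          have := x.2
          unfold pos par at *
          split_ifs at * <;> omega
        · intro x hx y hy
          have := key x hx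
          have := key y hy
          have := x.2
          have := y.2
          unfold pos par at *
          split_ifs at * <;> omega
      omega
  · have key := main (fun x => x ≠ w) (by simp) (by
      intro x y hx hy hxy
      have := x.2
      have := y.2
      rw [not_not] at hy
      subst hy
      refine ⟨?_, rfl⟩
      rw [hG] at hxy
      rw [Fin.ext_iff]
      unfold par at hxy hw'
      split_ifs at * <;> omega)
    have : (sd G w c).card ≤ 1 := by
      apply card_fin_le _ (fun x => 0)
      · intro x hx; omega
      · intro x hx y hy _
        have k1 := key x hx
        have k2 := key y hy
        rw [not_not] at k1 k2
        rw [k1, k2]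
    omega

lemma cat_mostar {n a b : ℕ} (hab : 2 * (a + b + 1) ≤ n) (h1 : b ≤ a) (h2 : a ≤ b + 1) :
    (catC n a b).IsTree ∧ oddDegreeCount (catC n a b) = 2 * (a + b + 1) ∧
    2 * (mostar (catC n a b) : ℤ) ≤ 2 * (n * (n - 1)) - V4 (n / 2 : ℕ) (n - 1 - n / 2 : ℕ) a b := by
  obtain ⟨m, hn⟩ : ∃ m, n = m + a + b := ⟨n - a - b, by omega⟩
  have hm : a + b + 2 ≤ m := by omega
  have hG := catC_isCat hn hm
  have hT := cat_isTree hn hm hG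
  refine ⟨hT, cat_odd hn hm hG, ?_⟩
  have hcn : n / 2 - a < n := by omega
  have hca : n / 2 - a + a = n / 2 := by omega
  have e1 := cat_Ds hn hm hG ⟨n / 2 - a, hcn⟩ (by simp only; omega) (by simp only; omega)
  have e2 := mostar_eq hT (c := ⟨n / 2 - a, hcn⟩) (fun w hw => by
    rw [Fintype.card_fin]
    exact cat_centroid hn hm hG _ (by simp only; omega) (by simp only; omega)
      (by simp only; omega) w hw)
  rw [Fintype.card_fin] at e2
  simp only [hca] at e1
  rw [e2]
  linarith

end MoAux

namespace MoAux
set_option linter.unusedSectionVars false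

lemma iso_of_hom {n : ℕ} {G H : SimpleGraph (Fin n)} (hG : G.IsTree) (hH : H.Connected)
    (g : Fin n → Fin n) (hg : Function.Surjective g)
    (hadj : ∀ x y, H.Adj x y → G.Adj (g x) (g y)) : Nonempty (G ≃g H) := by
  have hb : Function.Bijective g := ⟨Finite.injective_iff_surjective.2 hg, hg⟩
  let e : Fin n ≃ Fin n := Equiv.ofBijective g hb
  have he : ∀ x, e x = g x := fun _ => rfl
  let i := SimpleGraph.Iso.map e H
  have hc : (H.map e.toEmbedding).Connected := i.connected_iff.1 hH
  have hle : H.map e.toEmbedding ≤ G := by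
    intro x y hxy
    rw [SimpleGraph.map_adj] at hxy
    obtain ⟨x', y', h, rfl, rfl⟩ := hxy
    exact hadj _ _ h
  have hmin := isTree_iff_minimal_connected.1 hG
  have heq : H.map e.toEmbedding = G := le_antisymm hle (hmin.2 hc hle)
  rw [← heq]
  exact ⟨i.symm⟩

lemma iso_cat {n a b : ℕ} (hab : 2 * (a + b + 1) ≤ n) {G : SimpleGraph (Fin n)}
    (hG : G.IsTree) (hgood : Good G a b) : Nonempty (G ≃g catC n a b) := by
  obtain ⟨m, hn⟩ : ∃ m, n = m + a + b := ⟨n - a - b, by omega⟩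
  have hm : a + b + 2 ≤ m := by omega
  have hC := catC_isCat hn hm
  have hcon := cat_connected hn hm hC
  obtain ⟨u, v, huv, E1, E2, o1, o2⟩ := hgood
  obtain ⟨l, p, q, l1, l2, l3, l4, l5, l6⟩ := ext_shape hG u v huv E1 a o1
  obtain ⟨l', p', q', k1, k2, k3, k4, k5, k6⟩ := ext_shape hG v u huv.symm E2 b o2
  have hcs := card_split hG huv
  rw [Fintype.card_fin] at hcs
  have hml : m = l + l' + 2 := by omega
  let g : ℕ → Fin n := fun x =>
    if x ≤ l then p x else if x < m then p' (m - 1 - x) else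
      if x < m + a then q (x - m + 1) else q' (n - x)
  have g1 : ∀ i ≤ l, g i = p i := fun i hi => by simp only [g]; rw [if_pos hi]
  have g2 : ∀ i ≤ l', g (m - 1 - i) = p' i := fun i hi => by
    simp only [g]; rw [if_neg (by omega), if_pos (by omega)]; congr 1; omega
  have g3 : ∀ i, 1 ≤ i → i ≤ a → g (m + i - 1) = q i := fun i h1 h2 => by
    simp only [g]; rw [if_neg (by omega), if_neg (by omega), if_pos (by omega)]; congr 1; omega
  have g4 : ∀ i, 1 ≤ i → i ≤ b → g (n - i) = q' i := fun i h1 h2 => by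
    simp only [g]; rw [if_neg (by omega), if_neg (by omega), if_neg (by omega)]; congr 1; omega
  have hpar : ∀ x, 1 ≤ x → x < n → G.Adj (g x) (g (par m a b x)) := by
    intro x hx1 hx2
    rcases Nat.lt_or_ge x m with h | h
    · have e : par m a b x = x - 1 := by unfold par; rw [if_pos h]
      rw [e]
      rcases Nat.lt_or_ge l x with hl | hl
      · rcases Nat.eq_or_lt_of_le hl with hl | hl
        · have e1 : x = m - 1 - l' := by omega
          have e2 : x - 1 = l := by omega
          rw [e2, e1, g2 l' le_rfl, g1 l le_rfl, l3, k3]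
          exact huv.symm
        · obtain ⟨i, hi⟩ : ∃ i, x = m - 1 - i ∧ i + 1 ≤ l' := ⟨m - 1 - x, by omega⟩
          have e2 : x - 1 = m - 1 - (i + 1) := by omega
          rw [e2, hi.1, g2 i (by omega), g2 (i + 1) hi.2]
          exact k4 i (by omega)
      · obtain ⟨i, rfl⟩ : ∃ i, x = i + 1 := ⟨x - 1, by omega⟩
        rw [Nat.add_sub_cancel, g1 _ hl, g1 i (by omega)]
        exact (l4 i (by omega)).symm
    · rcases Nat.lt_or_ge x (m + a) with h' | h'
      · obtain ⟨i, rfl⟩ : ∃ i, x = m + i - 1 := ⟨x - m + 1, by omega⟩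
        have e : par m a b (m + i - 1) = i := by unfold par; split_ifs <;> omega
        rw [e, g3 i (by omega) (by omega), g1 i (by omega)]
        exact l5 i (by omega) (by omega)
      · obtain ⟨i, hi⟩ : ∃ i, x = n - i ∧ 1 ≤ i ∧ i ≤ b := ⟨n - x, by omega⟩
        have e : par m a b x = m - 1 - i := by unfold par; split_ifs <;> omega
        rw [e, hi.1, g4 i hi.2.1 hi.2.2, g2 i (by omega)]
        exact k5 i hi.2.1 hi.2.2
  apply iso_of_hom hG hcon (fun x => g x.val)
  · intro x
    by_cases hx : x ∈ sd G u v
    · rcases l6 x hx with ⟨i, hi, rfl⟩ | ⟨i, i1, i2, rfl⟩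
      · exact ⟨⟨i, by omega⟩, g1 i hi⟩
      · exact ⟨⟨m + i - 1, by omega⟩, g3 i i1 i2⟩
    · have hx' : x ∈ sd G v u := (mem_sd_compl hG huv).2 hx
      rcases k6 x hx' with ⟨i, hi, rfl⟩ | ⟨i, i1, i2, rfl⟩
      · exact ⟨⟨m - 1 - i, by omega⟩, g2 i hi⟩
      · exact ⟨⟨n - i, by omega⟩, g4 i i1 i2⟩
  · intro x y hxy
    rw [hC] at hxy
    rcases hxy with ⟨h1, h2⟩ | ⟨h1, h2⟩
    · simp only [← h2]; exact hpar _ h1 x.2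
    · simp only [← h2]; exact (hpar _ h1 y.2).symm

theorem main_aux (n k : ℕ) (hk1 : 1 ≤ k) (hk2 : k ≤ n / 2)
    (T : SimpleGraph (Fin n)) (hT : T.IsTree) (hodd : oddDegreeCount T = 2 * k)
    (hmin : ∀ T' : SimpleGraph (Fin n), T'.IsTree → oddDegreeCount T' = 2 * k →
      mostar T ≤ mostar T') :
    Nonempty (T ≃g catC n ((k - 1 + 1) / 2) ((k - 1) / 2)) := by
  have ek : k - 1 + 1 = k := by omega
  rw [ek]
  have hab : 2 * (k / 2 + (k - 1) / 2 + 1) ≤ n := by omega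
  obtain ⟨c1, c2, c3⟩ := cat_mostar hab (by omega) (by omega)
  have hm := hmin _ c1 (by rw [c2]; omega)
  obtain ⟨c, hc⟩ := centroid hT
  have hge := mostar_ge hT c
  rw [Fintype.card_fin] at hge
  have hmz : (mostar T : ℤ) ≤ mostar (catC n (k / 2) ((k - 1) / 2)) := by exact_mod_cast hm
  apply iso_cat hab hT
  exact good_edge hT n k (Fintype.card_fin n) hk1 (by omega) hodd c hc (by linarith)

end MoAux

/-- the tree minimizing the Mostar index among trees of order n with
exactly 2k odd vertices (1 ≤ k ≤ ⌊n/2⌋) is C_{n,⌈(k-1)/2⌉,⌊(k-1)/2⌋}. -/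
theorem min_mostar_odd_vertices (n k : ℕ) (hk1 : 1 ≤ k) (hk2 : k ≤ n / 2)
    (T : SimpleGraph (Fin n)) (hT : T.IsTree) (hodd : oddDegreeCount T = 2 * k)
    (hmin : ∀ T' : SimpleGraph (Fin n), T'.IsTree → oddDegreeCount T' = 2 * k →
      mostar T ≤ mostar T') :
    Nonempty (T ≃g catC n ((k - 1 + 1) / 2) ((k - 1) / 2)) := by
  exact MoAux.main_aux n k hk1 hk2 T hT hodd hmin
end
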